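/- arXiv:2002.01654 — 4 statements merged into one kernel-verified Lean document; each statement's English description precedes it below -/
import Mathlib

section
/- For every α ∈ ℝ there exists a function u ∈ C¹([0,t₀]) ∩ C²((0,t₀]) with u(0) = α and u'(0) = 0 satisfying equation (★) on (0,t₀]; any two such functions are equal; and there is a constant C, depending only on α, λ and q, such that |u(t)| ≤ C and |u'(t)| ≤ C for all t ∈ [0,t₀]. -/
open Set Filter

/-- `u` is a solution of the ODE `u'' + h u' + λ(|u|^{q-1} u - u) = 0`,
being C¹ on the closed set `S` (with derivative `u'`) and C² on `Sint`
(with second derivative `u''`), where the equation holds on `Sint`. -/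
def SolOn (h : ℝ → ℝ) (lam q : ℝ) (S Sint : Set ℝ) (u u' u'' : ℝ → ℝ) : Prop :=
  (∀ t ∈ S, HasDerivWithinAt u (u' t) S t) ∧
  ContinuousOn u' S ∧
  (∀ t ∈ Sint, HasDerivWithinAt u' (u'' t) Sint t) ∧
  ContinuousOn u'' Sint ∧
  (∀ t ∈ Sint, u'' t + h t * u' t + lam * (|u t| ^ (q - 1) * u t - u t) = 0)

/-- The Euclidean norm on ℝ². -/
noncomputable def enorm2 (p : ℝ × ℝ) : ℝ := Real.sqrt (p.1 ^ 2 + p.2 ^ 2)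

open MeasureTheory intervalIntegral

/-! ### Integrating factors and the averaging operator -/

/-- `p` is an integrating factor for `u'' + h u'` on `(0, d)`, nondecreasing on `[0, T]`. -/
structure IntegratingFactor (h p : ℝ → ℝ) (d T : ℝ) : Prop where
  mem : T ∈ Ioo 0 d
  mono : MonotoneOn p (Icc 0 T)
  pos : ∀ t ∈ Ioc 0 T, 0 < p t
  hasDerivAt : ∀ t ∈ Ioo 0 d, HasDerivAt p (h t * p t) t

/-- The solution operator `g ↦ v` of the singular first-order equation `v' + h v = g`, `v(0) = 0`. -/
noncomputable def weightedAverage (p g : ℝ → ℝ) (s : ℝ) : ℝ := (∫ r in (0 : ℝ)..s, p r * g r) / p s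

theorem exists_integratingFactor {h : ℝ → ℝ} {d T : ℝ} (hT : T ∈ Ioo 0 d)
    (hc : ContinuousOn h (Ioo 0 d)) (hpos : ∀ t ∈ Ioc 0 T, 0 ≤ h t) :
    ∃ p, IntegratingFactor h p d T := by
  set P : ℝ → ℝ := fun s => Real.exp (∫ r in T..s, h r) with hP
  have hPd : ∀ t ∈ Ioo 0 d, HasDerivAt P (h t * P t) t := by
    intro t ht
    have h1 : HasDerivAt (fun s => ∫ r in T..s, h r) (h t) t := by
      apply integral_hasDerivAt_right
      · apply ContinuousOn.intervalIntegrable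
        apply hc.mono
        intro x hx
        rcases le_total T t with h1 | h1
        · rw [uIcc_of_le h1] at hx
          exact ⟨hT.1.trans_le hx.1, hx.2.trans_lt ht.2⟩
        · rw [uIcc_of_ge h1] at hx
          exact ⟨ht.1.trans_le hx.1, hx.2.trans_lt hT.2⟩
      · exact hc.stronglyMeasurableAtFilter isOpen_Ioo t ht
      · exact hc.continuousAt (isOpen_Ioo.mem_nhds ht)
    simpa [hP, mul_comm] using h1.exp
  have hPm : MonotoneOn P (Ioc 0 T) := by
    apply monotoneOn_of_hasDerivWithinAt_nonneg (f' := fun t => h t * P t) (convex_Ioc 0 T)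
    · intro t ht
      exact (hPd t ⟨ht.1, ht.2.trans_lt hT.2⟩).continuousAt.continuousWithinAt
    · intro t ht
      rw [interior_Ioc] at ht
      exact (hPd t ⟨ht.1, ht.2.trans hT.2⟩).hasDerivWithinAt
    · intro t ht
      rw [interior_Ioc] at ht
      exact mul_nonneg (hpos t ⟨ht.1, ht.2.le⟩) (Real.exp_pos _).le
  set p : ℝ → ℝ := fun s => if s ≤ 0 then 0 else P s with hp
  have hev : ∀ t, 0 < t → p t = P t := fun t ht => by simp [hp, not_le.2 ht]
  refine ⟨p, hT, ?_, ?_, ?_⟩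
  · intro x hx y hy hxy
    rcases hx.1.eq_or_lt with h0 | h0
    · simp only [hp, ← h0, le_refl, if_true]
      split_ifs
      · exact le_rfl
      · exact (Real.exp_pos _).le
    · have hy0 := h0.trans_le hxy
      rw [hev x h0, hev y hy0]
      exact hPm ⟨h0, hx.2⟩ ⟨hy0, hy.2⟩ hxy
  · intro t ht
    rw [hev t ht.1]
    exact Real.exp_pos _
  · intro t ht
    rw [hev t ht.1]
    apply (hPd t ht).congr_of_eventuallyEq
    filter_upwards [Ioi_mem_nhds ht.1] with s hs using hev s hs

namespace IntegratingFactor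

variable {h p g : ℝ → ℝ} {d T : ℝ}

theorem intervalIntegrable_mul (H : IntegratingFactor h p d T) (hg : Continuous g) {s : ℝ}
    (hs : s ∈ Icc 0 T) : IntervalIntegrable (fun r => p r * g r) volume 0 s := by
  apply IntervalIntegrable.mul_continuousOn _ hg.continuousOn
  apply MonotoneOn.intervalIntegrable
  rw [uIcc_of_le hs.1]
  exact H.mono.mono (Icc_subset_Icc_right hs.2)

theorem hasDerivAt_weightedAverage (H : IntegratingFactor h p d T) (hg : Continuous g) {t : ℝ}
    (ht : t ∈ Ioc 0 T) :
    HasDerivAt (weightedAverage p g) (g t - h t * weightedAverage p g t) t := by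
  have htd : t ∈ Ioo 0 d := ⟨ht.1, ht.2.trans_lt H.mem.2⟩
  have hpc : ContinuousOn (fun r => p r * g r) (Ioo 0 d) := fun s hs =>
    ((H.hasDerivAt s hs).continuousAt.mul hg.continuousAt).continuousWithinAt
  have h1 : HasDerivAt (fun s => ∫ r in (0 : ℝ)..s, p r * g r) (p t * g t) t :=
    integral_hasDerivAt_right (H.intervalIntegrable_mul hg ⟨ht.1.le, ht.2⟩)
      (hpc.stronglyMeasurableAtFilter isOpen_Ioo t htd)
      (hpc.continuousAt (isOpen_Ioo.mem_nhds htd))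
  have hp := (H.pos t ht).ne'
  refine (h1.div (H.hasDerivAt t htd) hp).congr_deriv ?_
  unfold weightedAverage
  field_simp

theorem abs_weightedAverage_le (H : IntegratingFactor h p d T) (hg : Continuous g) {s : ℝ}
    (hs : s ∈ Icc 0 T) : |weightedAverage p g s| ≤ ∫ r in (0 : ℝ)..s, |g r| := by
  rcases hs.1.eq_or_lt with h0 | h0
  · simp [weightedAverage, ← h0]
  have hp := H.pos s ⟨h0, hs.2⟩
  rw [weightedAverage, abs_div, abs_of_pos hp, div_le_iff₀ hp, mul_comm, ← intervalIntegral.integral_const_mul,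
    ← Real.norm_eq_abs]
  apply norm_integral_le_of_norm_le h0.le _ ((hg.abs.const_mul _).intervalIntegrable _ _)
  refine Eventually.of_forall fun r hr => ?_
  rw [Real.norm_eq_abs, abs_mul, abs_of_pos (H.pos r ⟨hr.1, hr.2.trans hs.2⟩)]
  exact mul_le_mul_of_nonneg_right
    (H.mono ⟨hr.1.le, hr.2.trans hs.2⟩ hs hr.2) (abs_nonneg _)

theorem weightedAverage_zero : weightedAverage p g 0 = 0 := by simp [weightedAverage]

theorem continuousOn_weightedAverage (H : IntegratingFactor h p d T) (hg : Continuous g) :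
    ContinuousOn (weightedAverage p g) (Icc 0 T) := by
  intro t ht
  rcases ht.1.eq_or_lt with h0 | h0
  · subst h0
    rw [ContinuousWithinAt, weightedAverage_zero]
    have hlim : Tendsto (fun s => ∫ r in (0 : ℝ)..s, |g r|) (nhdsWithin 0 (Icc 0 T)) (nhds 0) := by
      have := (hg.abs.integral_hasStrictDerivAt 0 0).hasDerivAt.continuousAt.tendsto
      simp only [integral_same] at this
      exact this.mono_left nhdsWithin_le_nhds
    apply squeeze_zero_norm' _ hlim
    filter_upwards [self_mem_nhdsWithin] with s hs using H.abs_weightedAverage_le hg hs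
  · exact (H.hasDerivAt_weightedAverage hg ⟨h0, ht.2⟩).continuousAt.continuousWithinAt

theorem weightedAverage_sub (H : IntegratingFactor h p d T) {g₁ g₂ : ℝ → ℝ} (hg₁ : Continuous g₁)
    (hg₂ : Continuous g₂) {s : ℝ} (hs : s ∈ Icc 0 T) :
    weightedAverage p g₁ s - weightedAverage p g₂ s = weightedAverage p (fun r => g₁ r - g₂ r) s := by
  simp only [weightedAverage, mul_sub]
  rw [integral_sub (H.intervalIntegrable_mul hg₁ hs) (H.intervalIntegrable_mul hg₂ hs), sub_div]

end IntegratingFactor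

theorem integral_le_of_le_exp {w : ℝ → ℝ} {M K t : ℝ} (ht : 0 ≤ t) (hK : 0 < K) (hM : 0 ≤ M)
    (hw : IntervalIntegrable w volume 0 t) (hle : ∀ s ∈ Icc 0 t, w s ≤ M * Real.exp (K * s)) :
    ∫ s in (0 : ℝ)..t, w s ≤ M / K * Real.exp (K * t) := by
  have hc : Continuous fun s => M * Real.exp (K * s) := by fun_prop
  have h1 : ∫ s in (0 : ℝ)..t, M * Real.exp (K * s)
      = M / K * Real.exp (K * t) - M / K * Real.exp (K * 0) := by
    apply integral_eq_sub_of_hasDerivAt (f := fun s => M / K * Real.exp (K * s)) _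
      (hc.intervalIntegrable _ _)
    intro x _
    refine ((((hasDerivAt_id x).const_mul K).exp).const_mul (M / K)).congr_deriv ?_
    simp only [id]
    field_simp
  have h2 := integral_mono_on ht hw (hc.intervalIntegrable _ _) hle
  have h3 : 0 ≤ M / K * Real.exp (K * 0) := by positivity
  linarith

/-! ### Existence for globally Lipschitz nonlinearities -/

section Picard

variable {h p F : ℝ → ℝ} {d T lam α K : ℝ} {L : NNReal}

/-- The constant extension of `weightedAverage p g` from `[0, T]` to the line. -/
noncomputable def weightedAverageExtend (p : ℝ → ℝ) (T : ℝ) (g : ℝ → ℝ) (t : ℝ) : ℝ :=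
  weightedAverage p g (max 0 (min t T))

theorem weightedAverageExtend_of_mem {g : ℝ → ℝ} {t : ℝ} (ht : t ∈ Icc 0 T) :
    weightedAverageExtend p T g t = weightedAverage p g t := by
  simp [weightedAverageExtend, ht.1, ht.2]

theorem IntegratingFactor.continuous_weightedAverageExtend (H : IntegratingFactor h p d T)
    {g : ℝ → ℝ} (hg : Continuous g) : Continuous (weightedAverageExtend p T g) :=
  (H.continuousOn_weightedAverage hg).comp_continuous (by fun_prop)
    fun t => ⟨le_max_left _ _, max_le H.mem.1.le (min_le_right _ _)⟩

/-- Integrating twice against the weight `exp (K t)` gains a factor `K ^ 2`. -/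
theorem IntegratingFactor.abs_integral_sub_le (H : IntegratingFactor h p d T) {g₁ g₂ : ℝ → ℝ}
    (hg₁ : Continuous g₁) (hg₂ : Continuous g₂) {M : ℝ} (hK : 0 < K) (hM : 0 ≤ M)
    (hle : ∀ s ∈ Icc 0 T, |g₁ s - g₂ s| ≤ M * Real.exp (K * s)) {t : ℝ} (ht : t ∈ Icc 0 T) :
    |(∫ s in (0 : ℝ)..t, weightedAverageExtend p T g₁ s)
      - ∫ s in (0 : ℝ)..t, weightedAverageExtend p T g₂ s| ≤ M / K / K * Real.exp (K * t) := by
  have hc₁ := H.continuous_weightedAverageExtend hg₁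
  have hc₂ := H.continuous_weightedAverageExtend hg₂
  rw [← integral_sub (hc₁.intervalIntegrable _ _) (hc₂.intervalIntegrable _ _)]
  refine (abs_integral_le_integral_abs ht.1).trans
    (integral_le_of_le_exp ht.1 hK (by positivity) ((hc₁.sub hc₂).abs.intervalIntegrable _ _) ?_)
  intro s hs
  have hsT : s ∈ Icc 0 T := ⟨hs.1, hs.2.trans ht.2⟩
  rw [weightedAverageExtend_of_mem hsT, weightedAverageExtend_of_mem hsT,
    H.weightedAverage_sub hg₁ hg₂ hsT]
  refine (H.abs_weightedAverage_le (hg₁.sub hg₂) hsT).trans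
    (integral_le_of_le_exp hs.1 hK hM ((hg₁.sub hg₂).abs.intervalIntegrable _ _) ?_)
  exact fun r hr => hle r ⟨hr.1, hr.2.trans hsT.2⟩

theorem IntegratingFactor.exists_integral_solution (H : IntegratingFactor h p d T)
    (hlam : 0 < lam) (hF : LipschitzWith L F) (α : ℝ) :
    ∃ g : ℝ → ℝ, Continuous g ∧
      ∀ t ∈ Icc 0 T, g t = F (α - lam * ∫ s in (0 : ℝ)..t, weightedAverageExtend p T g s) := by
  have hT := H.mem.1.le
  set K : ℝ := 2 * lam * L + 1 with hKdef
  have hLn : (0 : ℝ) ≤ L := L.2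
  have hK : 0 < K := by positivity
  let G : C(Icc (0 : ℝ) T, ℝ) → ℝ → ℝ := fun v t =>
    F (Real.exp (K * t) * v (projIcc 0 T hT t))
  have hG : ∀ v, Continuous (G v) := fun v =>
    hF.continuous.comp ((by fun_prop : Continuous fun t : ℝ => Real.exp (K * t)).mul
      (v.continuous.comp continuous_projIcc))
  have hU : ∀ v, Continuous fun t : ℝ =>
      α - lam * ∫ s in (0 : ℝ)..t, weightedAverageExtend p T (G v) s := fun v => by
    have := continuous_primitive
      (fun a b => (H.continuous_weightedAverageExtend (hG v)).intervalIntegrable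
        (μ := volume) a b) 0
    fun_prop
  let Φ : C(Icc (0 : ℝ) T, ℝ) → C(Icc (0 : ℝ) T, ℝ) := fun v =>
    ⟨fun t => Real.exp (-(K * t)) *
      (α - lam * ∫ s in (0 : ℝ)..t, weightedAverageExtend p T (G v) s),
      (by fun_prop : Continuous fun t : Icc (0 : ℝ) T => Real.exp (-(K * t))).mul
        ((hU v).comp continuous_subtype_val)⟩
  have hΦ : ContractingWith (1 / 2) Φ := by
    refine ⟨by norm_num [← NNReal.coe_lt_coe], LipschitzWith.of_dist_le_mul fun v₁ v₂ => ?_⟩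
    rw [ContinuousMap.dist_le (by positivity)]
    rintro ⟨t, ht⟩
    have hle : ∀ s ∈ Icc 0 T, |G v₁ s - G v₂ s| ≤ (L * dist v₁ v₂) * Real.exp (K * s) := by
      intro s hs
      have h1 := hF.dist_le_mul (Real.exp (K * s) * v₁ (projIcc 0 T hT s))
        (Real.exp (K * s) * v₂ (projIcc 0 T hT s))
      have h2 : dist (v₁ (projIcc 0 T hT s)) (v₂ (projIcc 0 T hT s)) ≤ dist v₁ v₂ :=
        ContinuousMap.dist_apply_le_dist _
      rw [Real.dist_eq, Real.dist_eq, ← mul_sub, abs_mul, Real.abs_exp] at h1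
      rw [Real.dist_eq] at h2
      calc _ ≤ _ := h1
        _ ≤ L * (Real.exp (K * s) * dist v₁ v₂) := by gcongr
        _ = _ := by ring
    have h3 := H.abs_integral_sub_le (hG v₁) (hG v₂) hK (by positivity) hle ht
    have h4 : lam * (L * dist v₁ v₂ / K / K) ≤ 1 / 2 * dist v₁ v₂ := by
      have : lam * L / K / K ≤ 1 / 2 := by
        rw [div_div, div_le_iff₀ (by positivity)]
        nlinarith [mul_nonneg hlam.le hLn]
      calc _ = lam * L / K / K * dist v₁ v₂ := by ring
        _ ≤ _ := by gcongr
    rw [Real.dist_eq]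
    change |Real.exp (-(K * t)) * _ - Real.exp (-(K * t)) * _| ≤ (1 / 2 : ℝ) * _
    rw [← mul_sub, abs_mul, Real.abs_exp, sub_sub_sub_cancel_left, ← mul_sub, abs_mul,
      abs_of_pos hlam, abs_sub_comm]
    calc _ ≤ Real.exp (-(K * t)) * (lam * (L * dist v₁ v₂ / K / K * Real.exp (K * t))) := by gcongr
      _ = lam * (L * dist v₁ v₂ / K / K) * (Real.exp (-(K * t)) * Real.exp (K * t)) := by ring
      _ = lam * (L * dist v₁ v₂ / K / K) := by rw [← Real.exp_add]; simp
      _ ≤ _ := h4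
  obtain ⟨v, hv⟩ : ∃ v, Φ v = v := ⟨_, hΦ.fixedPoint_isFixedPt⟩
  refine ⟨G v, hG v, fun t ht => ?_⟩
  have h1 : v ⟨t, ht⟩ = Real.exp (-(K * t)) *
      (α - lam * ∫ s in (0 : ℝ)..t, weightedAverageExtend p T (G v) s) :=
    (DFunLike.congr_fun hv ⟨t, ht⟩).symm
  change F (Real.exp (K * t) * v (projIcc 0 T hT t)) = _
  rw [projIcc_of_mem hT ht, h1, ← mul_assoc, ← Real.exp_add]
  simp

/-- `u` is a solution of `u'' + h u' + λ F(u) = 0` on `[0, T]` with `u 0 = α`, `u' 0 = 0`. -/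
structure IsRadialSol (h F : ℝ → ℝ) (lam T α : ℝ) (u u' u'' : ℝ → ℝ) : Prop where
  hasDeriv : ∀ t ∈ Icc 0 T, HasDerivWithinAt u (u' t) (Icc 0 T) t
  continuousOn_deriv : ContinuousOn u' (Icc 0 T)
  hasDeriv₂ : ∀ t ∈ Ioc 0 T, HasDerivWithinAt u' (u'' t) (Ioc 0 T) t
  continuousOn_deriv₂ : ContinuousOn u'' (Ioc 0 T)
  eqn : ∀ t ∈ Ioc 0 T, u'' t + h t * u' t + lam * F (u t) = 0
  apply_zero : u 0 = α
  deriv_apply_zero : u' 0 = 0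

theorem IntegratingFactor.exists_isRadialSol (H : IntegratingFactor h p d T)
    (hc : ContinuousOn h (Ioo 0 d)) (hlam : 0 < lam) (hF : LipschitzWith L F) (α : ℝ) :
    ∃ u u' u'' : ℝ → ℝ, IsRadialSol h F lam T α u u' u'' := by
  obtain ⟨g, hg, hgF⟩ := H.exists_integral_solution hlam hF α
  have hcE := H.continuous_weightedAverageExtend hg
  have hsub : Ioc 0 T ⊆ Ioo 0 d := fun t ht => ⟨ht.1, ht.2.trans_lt H.mem.2⟩
  refine ⟨fun t => α - lam * ∫ s in (0 : ℝ)..t, weightedAverageExtend p T g s,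
    fun t => -(lam * weightedAverage p g t),
    fun t => -(lam * (g t - h t * weightedAverage p g t)), ?_, ?_, ?_, ?_, ?_, ?_, ?_⟩
  · intro t ht
    rw [← weightedAverageExtend_of_mem ht]
    exact (((hcE.integral_hasStrictDerivAt 0 t).hasDerivAt.const_mul lam).const_sub
      α).hasDerivWithinAt
  · exact ((H.continuousOn_weightedAverage hg).const_mul lam).neg
  · intro t ht
    exact ((H.hasDerivAt_weightedAverage hg ht).const_mul lam).neg.hasDerivWithinAt
  · exact (((hg.continuousOn.sub ((hc.mono hsub).mul
      ((H.continuousOn_weightedAverage hg).mono Ioc_subset_Icc_self))).const_mul lam)).neg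
  · intro t ht
    have := hgF t ⟨ht.1.le, ht.2⟩
    simp only [← this]
    ring
  · simp
  · simp [IntegratingFactor.weightedAverage_zero]

end Picard

/-! ### Energy and uniqueness -/

namespace IsRadialSol

variable {h F G u u' u'' v v' v'' : ℝ → ℝ} {lam T α : ℝ} {L : NNReal}

theorem continuousOn (S : IsRadialSol h F lam T α u u' u'') : ContinuousOn u (Icc 0 T) :=
  fun t ht => (S.hasDeriv t ht).continuousWithinAt

theorem hasDerivAt (S : IsRadialSol h F lam T α u u' u'') {t : ℝ} (ht : t ∈ Ioo 0 T) :
    HasDerivAt u (u' t) t :=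
  (S.hasDeriv t (Ioo_subset_Icc_self ht)).hasDerivAt (Icc_mem_nhds ht.1 ht.2)

theorem hasDerivAt₂ (S : IsRadialSol h F lam T α u u' u'') {t : ℝ} (ht : t ∈ Ioo 0 T) :
    HasDerivAt u' (u'' t) t :=
  (S.hasDeriv₂ t (Ioo_subset_Ioc_self ht)).hasDerivAt (Ioc_mem_nhds ht.1 ht.2)

/-- The nonlinearity may be changed away from the range of the solution. -/
theorem congr {F' : ℝ → ℝ} {T' : ℝ} (S : IsRadialSol h F lam T α u u' u'') (hT : T' ≤ T)
    (hF : ∀ t ∈ Ioc 0 T', F (u t) = F' (u t)) : IsRadialSol h F' lam T' α u u' u'' where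
  hasDeriv t ht := (S.hasDeriv t (Icc_subset_Icc_right hT ht)).mono (Icc_subset_Icc_right hT)
  continuousOn_deriv := S.continuousOn_deriv.mono (Icc_subset_Icc_right hT)
  hasDeriv₂ t ht := (S.hasDeriv₂ t (Ioc_subset_Ioc_right hT ht)).mono (Ioc_subset_Ioc_right hT)
  continuousOn_deriv₂ := S.continuousOn_deriv₂.mono (Ioc_subset_Ioc_right hT)
  eqn t ht := by
    rw [← hF t ht]
    exact S.eqn t (Ioc_subset_Ioc_right hT ht)
  apply_zero := S.apply_zero
  deriv_apply_zero := S.deriv_apply_zero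

theorem energy_le (S : IsRadialSol h F lam T α u u' u'') (hh : ∀ t ∈ Ioc 0 T, 0 ≤ h t)
    (hG : ∀ x, HasDerivAt G (F x) x) {t : ℝ} (ht : t ∈ Icc 0 T) :
    u' t ^ 2 / 2 + lam * G (u t) ≤ lam * G α := by
  have hGc : Continuous G := continuous_iff_continuousAt.2 fun x => (hG x).continuousAt
  have hmono : AntitoneOn (fun t => u' t ^ 2 / 2 + lam * G (u t)) (Icc 0 T) := by
    apply antitoneOn_of_hasDerivWithinAt_nonpos (f' := fun t => -(h t * u' t ^ 2)) (convex_Icc 0 T)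
    · exact ((S.continuousOn_deriv.pow 2).div_const 2).add
        ((hGc.comp_continuousOn S.continuousOn).const_mul lam)
    · intro t ht
      rw [interior_Icc] at ht
      have h1 := (((S.hasDerivAt₂ ht).pow 2).div_const 2).add
        (((hG (u t)).comp t (S.hasDerivAt ht)).const_mul lam)
      refine (h1.congr_deriv ?_).hasDerivWithinAt
      have := S.eqn t (Ioo_subset_Ioc_self ht)
      push_cast
      linear_combination u' t * this
    · intro t ht
      rw [interior_Icc] at ht
      have := mul_nonneg (hh t (Ioo_subset_Ioc_self ht)) (sq_nonneg (u' t))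
      linarith
  have := hmono ⟨le_rfl, ht.1.trans ht.2⟩ ht ht.1
  simpa [S.apply_zero, S.deriv_apply_zero] using this

theorem unique (S : IsRadialSol h F lam T α u u' u'') (S' : IsRadialSol h F lam T α v v' v'')
    (hlam : 0 < lam) (hh : ∀ t ∈ Ioc 0 T, 0 ≤ h t) (hF : LipschitzWith L F) :
    ∀ t ∈ Icc 0 T, u t = v t := by
  set K : ℝ := 1 + lam * L with hK
  let E : ℝ → ℝ := fun t => (u t - v t) ^ 2 + (u' t - v' t) ^ 2
  have hmono : AntitoneOn (fun t => Real.exp (-(K * t)) * E t) (Icc 0 T) := by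
    apply antitoneOn_of_hasDerivWithinAt_nonpos (convex_Icc 0 T)
      (f' := fun t => Real.exp (-(K * t)) * (-K) * E t + Real.exp (-(K * t)) *
        (2 * (u t - v t) * (u' t - v' t) + 2 * (u' t - v' t) * (u'' t - v'' t)))
    · exact (by fun_prop : Continuous fun t : ℝ => Real.exp (-(K * t))).continuousOn.mul
        (((S.continuousOn.sub S'.continuousOn).pow 2).add
          ((S.continuousOn_deriv.sub S'.continuousOn_deriv).pow 2))
    · intro t ht
      rw [interior_Icc] at ht
      have h1 := (((hasDerivAt_id t).const_mul K).neg.exp).mul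
        ((((S.hasDerivAt ht).sub (S'.hasDerivAt ht)).pow 2).add
          (((S.hasDerivAt₂ ht).sub (S'.hasDerivAt₂ ht)).pow 2))
      refine (h1.congr_deriv ?_).hasDerivWithinAt
      simp [E]
    · intro t ht
      rw [interior_Icc] at ht
      have e1 := S.eqn t (Ioo_subset_Ioc_self ht)
      have e2 := S'.eqn t (Ioo_subset_Ioc_self ht)
      have h0 := hh t (Ioo_subset_Ioc_self ht)
      have hL : |F (u t) - F (v t)| ≤ L * |u t - v t| := hF.dist_le_mul (u t) (v t)
      set a := u t - v t with ha
      set b := u' t - v' t with hb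
      set c := F (u t) - F (v t) with hcc
      have e3 : u'' t - v'' t = -(h t * b) - lam * c := by
        rw [hb, hcc]; linear_combination e1 - e2
      have hE : E t = a ^ 2 + b ^ 2 := rfl
      have hbc : -(b * c) ≤ L * (|a| * |b|) := by
        calc -(b * c) ≤ |b * c| := neg_le_abs _
          _ = |b| * |c| := abs_mul _ _
          _ ≤ |b| * (L * |a|) := by gcongr
          _ = _ := by ring
      have hab : 2 * (|a| * |b|) ≤ a ^ 2 + b ^ 2 := by
        nlinarith [sq_nonneg (|a| - |b|), sq_abs a, sq_abs b]
      have hab' : 2 * (a * b) ≤ a ^ 2 + b ^ 2 := by nlinarith [sq_nonneg (a - b)]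
      have key : 2 * a * b + 2 * b * (u'' t - v'' t) ≤ K * E t := by
        rw [e3, hE, hK]
        have h5 : lam * (-(b * c)) ≤ lam * (L * (|a| * |b|)) := by gcongr
        have h6 : lam * L * (2 * (|a| * |b|)) ≤ lam * L * (a ^ 2 + b ^ 2) := by gcongr
        nlinarith [mul_nonneg h0 (sq_nonneg b)]
      have := mul_le_mul_of_nonneg_left key (Real.exp_pos (-(K * t))).le
      linarith
  intro t ht
  have h1 := hmono ⟨le_rfl, ht.1.trans ht.2⟩ ht ht.1
  simp only [E, S.apply_zero, S'.apply_zero, S.deriv_apply_zero, S'.deriv_apply_zero, sub_self] at h1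
  have h2 : (u t - v t) ^ 2 + (u' t - v' t) ^ 2 ≤ 0 := by
    by_contra! hlt
    have := mul_pos (Real.exp_pos (-(K * t))) hlt
    norm_num at h1
    linarith
  have h3 : (u t - v t) ^ 2 = 0 := by nlinarith [sq_nonneg (u t - v t), sq_nonneg (u' t - v' t)]
  exact sub_eq_zero.1 (pow_eq_zero_iff two_ne_zero |>.1 h3)

end IsRadialSol

/-! ### The power nonlinearity -/

section Power

variable {q : ℝ}

/-- The potential of `x ↦ |x| ^ (q - 1) * x - x`. -/
noncomputable def powerPotential (q x : ℝ) : ℝ := |x| ^ (q + 1) / (q + 1) - x ^ 2 / 2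

theorem hasDerivAt_powerPotential (hq : 1 < q) (x : ℝ) :
    HasDerivAt (powerPotential q) (|x| ^ (q - 1) * x - x) x := by
  have h1 := ((hasDerivAt_abs_rpow x (by linarith : 1 < q + 1)).div_const (q + 1)).sub
    (((hasDerivAt_id x).pow 2).div_const 2)
  refine h1.congr_deriv ?_
  have : q + 1 ≠ 0 := by linarith
  rw [show q + 1 - 2 = q - 1 by ring]
  simp only [id]
  field_simp
  ring

theorem abs_le_or_sq_le_powerPotential (hq : 1 < q) (x : ℝ) :
    |x| ≤ (q + 1) ^ (q - 1)⁻¹ ∨ x ^ 2 ≤ 2 * powerPotential q x := by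
  refine or_iff_not_imp_left.2 fun hx => ?_
  rw [not_le] at hx
  have hq1 : 0 < q + 1 := by linarith
  have hx0 : 0 < |x| := (Real.rpow_pos_of_pos hq1 _).trans hx
  have h1 : q + 1 ≤ |x| ^ (q - 1) := by
    have := Real.rpow_le_rpow (by positivity) hx.le (by linarith : 0 ≤ q - 1)
    rwa [← Real.rpow_mul hq1.le, inv_mul_cancel₀ (by linarith), Real.rpow_one] at this
  have h2 : |x| ^ (q + 1) = |x| ^ (q - 1) * x ^ 2 := by
    rw [show q + 1 = (q - 1) + 2 by ring, Real.rpow_add hx0]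
    simp
  have h3 : x ^ 2 ≤ |x| ^ (q + 1) / (q + 1) := by
    rw [h2, le_div_iff₀ hq1, mul_comm]
    gcongr
  unfold powerPotential
  linarith

/-- An a priori bound for `|u|` and `|u'|` along trajectories of nonincreasing energy. -/
noncomputable def energyBound (α lam q : ℝ) : ℝ :=
  (q + 1) ^ (q - 1)⁻¹ + √(2 * |powerPotential q α|) +
    √(lam * (2 * |powerPotential q α| + ((q + 1) ^ (q - 1)⁻¹) ^ 2))

theorem le_energyBound {lam α x y : ℝ} (hq : 1 < q) (hlam : 0 < lam)
    (hE : y ^ 2 / 2 + lam * powerPotential q x ≤ lam * powerPotential q α) :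
    |x| ≤ energyBound α lam q ∧ |y| ≤ energyBound α lam q := by
  set X := (q + 1) ^ (q - 1)⁻¹ with hX
  have hX0 : 0 ≤ X := Real.rpow_nonneg (by linarith) _
  have hs1 := Real.sqrt_nonneg (2 * |powerPotential q α|)
  have hs2 := Real.sqrt_nonneg (lam * (2 * |powerPotential q α| + X ^ 2))
  have hα := le_abs_self (powerPotential q α)
  have hG : powerPotential q x ≤ powerPotential q α := by
    refine le_of_mul_le_mul_left ?_ hlam
    nlinarith [sq_nonneg y]
  have hlow : -(X ^ 2) ≤ 2 * powerPotential q x := by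
    rcases abs_le_or_sq_le_powerPotential hq x with h1 | h1
    · have h2 : x ^ 2 ≤ X ^ 2 := sq_le_sq.2 (by rwa [abs_of_nonneg hX0])
      have h3 : 0 ≤ |x| ^ (q + 1) / (q + 1) := by
        have : 0 ≤ q + 1 := by linarith
        positivity
      unfold powerPotential
      linarith
    · nlinarith [sq_nonneg x, sq_nonneg X]
  constructor
  · have : |x| ≤ X + √(2 * |powerPotential q α|) := by
      rcases abs_le_or_sq_le_powerPotential hq x with h1 | h1
      · exact h1.trans (by linarith)
      · have : |x| ≤ √(2 * |powerPotential q α|) := Real.abs_le_sqrt (by linarith)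
        linarith
    unfold energyBound
    linarith
  · have : |y| ≤ √(lam * (2 * |powerPotential q α| + X ^ 2)) := Real.abs_le_sqrt (by nlinarith)
    unfold energyBound
    linarith

theorem exists_lipschitz_eq_power (hq : 1 < q) {R : ℝ} (hR : 0 ≤ R) :
    ∃ (F : ℝ → ℝ) (L : NNReal), LipschitzWith L F ∧
      ∀ x, |x| ≤ R → |x| ^ (q - 1) * x - x = F x := by
  let c : ℝ → ℝ := fun x => max 0 (min x R)
  have hc : ∀ x, c x ∈ Icc 0 R := fun x => ⟨le_max_left _ _, max_le hR (min_le_right _ _)⟩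
  have hcL : LipschitzWith 1 c := (LipschitzWith.id.min_const R).const_max 0
  have hpow : LipschitzOnWith (Real.toNNReal (q * R ^ (q - 1))) (fun x : ℝ => x ^ q) (Icc 0 R) := by
    apply Convex.lipschitzOnWith_of_nnnorm_hasDerivWithin_le (convex_Icc 0 R)
      (f' := fun x => q * x ^ (q - 1))
    · intro x _
      exact (Real.hasDerivAt_rpow_const (Or.inr hq.le)).hasDerivWithinAt
    · intro x hx
      have h0 : 0 ≤ q * x ^ (q - 1) := mul_nonneg (by linarith) (Real.rpow_nonneg hx.1 _)
      rw [← NNReal.coe_le_coe, coe_nnnorm, Real.norm_of_nonneg h0]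
      refine le_trans ?_ (Real.le_coe_toNNReal _)
      exact mul_le_mul_of_nonneg_left
        (Real.rpow_le_rpow hx.1 hx.2 (by linarith)) (by linarith)
  have hp := lipschitzOnWith_univ.1 (hpow.comp hcL.lipschitzOnWith fun x _ => hc x)
  refine ⟨fun x => c x ^ q - c (-x) ^ q - x, _,
    (hp.sub (hp.comp LipschitzWith.id.neg)).sub LipschitzWith.id, ?_⟩
  intro x hx
  obtain ⟨h1, h2⟩ := abs_le.1 hx
  have hmul : ∀ y : ℝ, 0 ≤ y → y ^ q = y ^ (q - 1) * y := fun y hy => by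
    rw [← Real.rpow_add_one' hy (by linarith), sub_add_cancel]
  have h0 : (0 : ℝ) ^ q = 0 := Real.zero_rpow (by linarith)
  rcases le_total 0 x with h | h
  · have e1 : c x = x := by simp [c, h, h2]
    have e2 : c (-x) = 0 := by simp [c, h]
    simp only [e1, e2, h0, hmul x h, abs_of_nonneg h]
    ring
  · have e1 : c (-x) = -x := by simp [c, h, neg_le.1 h1]
    have e2 : c x = 0 := by simp [c, h]
    simp only [e1, e2, h0, hmul (-x) (neg_nonneg.2 h), abs_of_nonpos h]
    ring

end Power

variable {h u u' u'' : ℝ → ℝ} {lam q T α : ℝ}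

theorem IsRadialSol.bound
    (S : IsRadialSol h (fun x => |x| ^ (q - 1) * x - x) lam T α u u' u'')
    (hq : 1 < q) (hlam : 0 < lam) (hh : ∀ t ∈ Ioc 0 T, 0 ≤ h t) :
    ∀ t ∈ Icc 0 T, |u t| ≤ energyBound α lam q ∧ |u' t| ≤ energyBound α lam q :=
  fun _ ht => le_energyBound hq hlam (S.energy_le hh (hasDerivAt_powerPotential hq) ht)

theorem IsRadialSol.of_truncated {F : ℝ → ℝ} {R : ℝ} (S : IsRadialSol h F lam T α u u' u'')
    (hq : 1 < q) (hlam : 0 < lam) (hh : ∀ t ∈ Ioc 0 T, 0 ≤ h t)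
    (hR : energyBound α lam q < R) (hF : ∀ x, |x| ≤ R → |x| ^ (q - 1) * x - x = F x) :
    IsRadialSol h (fun x => |x| ^ (q - 1) * x - x) lam T α u u' u'' := by
  suffices hb : ∀ t ∈ Icc 0 T, |u t| < R from
    S.congr le_rfl fun t ht => (hF _ (hb t (Ioc_subset_Icc_self ht)).le).symm
  by_contra! hex
  set B := {t ∈ Icc 0 T | R ≤ |u t|} with hB
  have hne : B.Nonempty := hex
  have hBb : BddBelow B := ⟨0, fun t ht => ht.1.1⟩
  have hBc : IsClosed B := by
    have := S.continuousOn.abs.preimage_isClosed_of_isClosed isClosed_Icc (isClosed_Ici (a := R))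
    exact this
  have hmem : sInf B ∈ B := hBc.csInf_mem hne hBb
  set t₁ := sInf B
  have hlt : ∀ t ∈ Icc 0 T, t < t₁ → |u t| < R := fun t ht htt => by
    by_contra! hcon
    exact (csInf_le hBb ⟨ht, hcon⟩).not_gt htt
  have hα : |α| < R := (le_energyBound (y := 0) hq hlam (by simp)).1.trans_lt hR
  have hle : |u t₁| ≤ R := by
    by_contra! hcon
    obtain ⟨t, ht, htR⟩ := intermediate_value_Icc hmem.1.1
      (S.continuousOn.abs.mono (Icc_subset_Icc_right hmem.1.2))
      (show R ∈ Icc |u 0| |u t₁| from ⟨by rw [S.apply_zero]; exact hα.le, hcon.le⟩)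
    have hne₁ : t ≠ t₁ := by
      rintro rfl
      exact hcon.ne' htR
    exact (hlt t ⟨ht.1, ht.2.trans hmem.1.2⟩ (ht.2.lt_of_ne hne₁)).ne htR
  have S₁ : IsRadialSol h (fun x => |x| ^ (q - 1) * x - x) lam t₁ α u u' u'' := by
    refine S.congr hmem.1.2 fun t ht => (hF _ ?_).symm
    rcases ht.2.eq_or_lt with rfl | h1
    · exact hle
    · exact (hlt t ⟨ht.1.le, ht.2.trans hmem.1.2⟩ h1).le
  have h1 := (S₁.bound hq hlam (fun t ht => hh t ⟨ht.1, ht.2.trans hmem.1.2⟩) t₁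
    ⟨hmem.1.1, le_rfl⟩).1
  exact (h1.trans_lt hR).not_ge hmem.2

theorem SolOn.isRadialSol (S : SolOn h lam q (Icc 0 T) (Ioc 0 T) u u' u'') (h0 : u 0 = α)
    (h0' : u' 0 = 0) : IsRadialSol h (fun x => |x| ^ (q - 1) * x - x) lam T α u u' u'' :=
  ⟨S.1, S.2.1, S.2.2.1, S.2.2.2.1, S.2.2.2.2, h0, h0'⟩

theorem IsRadialSol.solOn
    (S : IsRadialSol h (fun x => |x| ^ (q - 1) * x - x) lam T α u u' u'') :
    SolOn h lam q (Icc 0 T) (Ioc 0 T) u u' u'' :=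
  ⟨S.hasDeriv, S.continuousOn_deriv, S.hasDeriv₂, S.continuousOn_deriv₂, S.eqn⟩

theorem stmt_5 :
    ∃ C : ℝ → ℝ → ℝ → ℝ,
    ∀ (d lam : ℝ), 0 < d → 0 < lam →
    ∀ (n m₁ m₂ : ℤ), 3 ≤ n → 0 ≤ m₁ → m₁ ≤ n - 2 → 0 ≤ m₂ → m₂ ≤ n - 2 →
    ∀ h : ℝ → ℝ, ContDiffOn ℝ 1 h (Set.Ioo 0 d) →
    (∀ t ∈ Set.Ioo 0 d, deriv h t < 0) →
    Filter.Tendsto (fun t => t * h t) (nhdsWithin 0 (Set.Ioi 0))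
      (nhds ((n : ℝ) - (m₁ : ℝ) - 1)) →
    Filter.Tendsto (fun t => (t - d) * h t) (nhdsWithin d (Set.Iio d))
      (nhds ((n : ℝ) - (m₂ : ℝ) - 1)) →
    ∀ q : ℝ, 1 < q →
    ∀ t₀ : ℝ, t₀ ∈ Set.Ioo 0 d →
    (∀ t ∈ Set.Ioo 0 t₀, 0 < h t) → (∀ t ∈ Set.Ioo t₀ d, h t < 0) →
    ∀ α : ℝ,
      (∃ u u' u'' : ℝ → ℝ,
        SolOn h lam q (Set.Icc 0 t₀) (Set.Ioc 0 t₀) u u' u'' ∧ u 0 = α ∧ u' 0 = 0) ∧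
      (∀ u₁ u₁' u₁'' u₂ u₂' u₂'' : ℝ → ℝ,
        SolOn h lam q (Set.Icc 0 t₀) (Set.Ioc 0 t₀) u₁ u₁' u₁'' → u₁ 0 = α → u₁' 0 = 0 →
        SolOn h lam q (Set.Icc 0 t₀) (Set.Ioc 0 t₀) u₂ u₂' u₂'' → u₂ 0 = α → u₂' 0 = 0 →
        ∀ t ∈ Set.Icc 0 t₀, u₁ t = u₂ t) ∧
      (∀ u u' u'' : ℝ → ℝ,
        SolOn h lam q (Set.Icc 0 t₀) (Set.Ioc 0 t₀) u u' u'' → u 0 = α → u' 0 = 0 →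
        ∀ t ∈ Set.Icc 0 t₀, |u t| ≤ C α lam q ∧ |u' t| ≤ C α lam q) := by
  refine ⟨energyBound, ?_⟩
  intro d lam _ hlam n m₁ m₂ _ _ _ _ _ h hC _ _ _ q hq t₀ ht₀ hpos _ α
  have hc := hC.continuousOn
  have hh : ∀ t ∈ Ioc 0 t₀, 0 ≤ h t := by
    intro t ht
    rcases ht.2.eq_or_lt with rfl | h1
    · have hcl : ContinuousWithinAt h (Ioo 0 t) t :=
        (hc t ht₀).mono (Ioo_subset_Ioo_right ht₀.2.le)
      have hmem : t ∈ closure (Ioo 0 t) := by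
        rw [closure_Ioo ht.1.ne]
        exact ⟨ht.1.le, le_rfl⟩
      exact ContinuousWithinAt.closure_le hmem continuousWithinAt_const hcl
        fun s hs => (hpos s hs).le
    · exact (hpos t ⟨ht.1, h1⟩).le
  refine ⟨?_, ?_, ?_⟩
  · have hR : 0 ≤ energyBound α lam q + 1 := by
      have := (le_energyBound (α := α) (x := α) (y := 0) hq hlam (by simp)).1
      linarith [abs_nonneg α]
    obtain ⟨F, L, hFL, hF⟩ := exists_lipschitz_eq_power hq hR
    obtain ⟨p, H⟩ := exists_integratingFactor ht₀ hc hh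
    obtain ⟨u, u', u'', S⟩ := H.exists_isRadialSol hc hlam hFL α
    exact ⟨u, u', u'', (S.of_truncated hq hlam hh (lt_add_one _) hF).solOn, S.apply_zero, S.deriv_apply_zero⟩
  · intro u₁ u₁' u₁'' u₂ u₂' u₂'' S₁ h₁ h₁' S₂ h₂ h₂'
    have R₁ := S₁.isRadialSol h₁ h₁'
    have R₂ := S₂.isRadialSol h₂ h₂'
    have hR : 0 ≤ energyBound α lam q :=
      (abs_nonneg α).trans (le_energyBound (y := 0) hq hlam (by simp)).1
    obtain ⟨F, L, hFL, hF⟩ := exists_lipschitz_eq_power hq hR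
    exact (R₁.congr le_rfl fun t ht =>
      hF _ (R₁.bound hq hlam hh t (Ioc_subset_Icc_self ht)).1).unique
      (R₂.congr le_rfl fun t ht => hF _ (R₂.bound hq hlam hh t (Ioc_subset_Icc_self ht)).1)
      hlam hh hFL
  · intro u u' u'' S h0 h0'
    exact (S.isRadialSol h0 h0').bound hq hlam hh
end

section
/- For every ε ∈ (0,t₀] and every positive integer k there exists α_k > 0 such that for every α ≥ α_k the solution u_α has at least k zeros in the open interval (0,ε). -/
open Set Filter

/-- The force term of the radial equation. -/
noncomputable def radialForce (lam q x : ℝ) : ℝ := lam * (|x| ^ (q - 1) * x - x)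

/-- The energy of the radial equation at position `x` and velocity `v`. -/
noncomputable def radialEnergy (lam q x v : ℝ) : ℝ :=
  v ^ 2 / 2 + lam * (|x| ^ (q + 1) / (q + 1) - x ^ 2 / 2)

/-- `u`, with derivative `v`, solves the radial equation on `(0, T)` and is C¹ up to the ends. -/
structure IsRadialSol_s6 (h : ℝ → ℝ) (lam q T : ℝ) (u v : ℝ → ℝ) : Prop where
  continuousOn_fst : ContinuousOn u (Icc 0 T)
  continuousOn_snd : ContinuousOn v (Icc 0 T)
  hasDerivAt_fst : ∀ t ∈ Ioo 0 T, HasDerivAt u (v t) t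
  hasDerivAt_snd : ∀ t ∈ Ioo 0 T, HasDerivAt v (-(h t * v t) - radialForce lam q (u t)) t

theorem le_of_hasDerivAt_nonneg {g g' : ℝ → ℝ} {x y : ℝ} (hxy : x ≤ y)
    (hc : ContinuousOn g (Icc x y)) (hd : ∀ t ∈ Ioo x y, HasDerivAt g (g' t) t)
    (hg : ∀ t ∈ Ioo x y, 0 ≤ g' t) : g x ≤ g y := by
  have hm : MonotoneOn g (Icc x y) := by
    apply monotoneOn_of_deriv_nonneg (convex_Icc x y) hc
    · rw [interior_Icc]
      exact fun t ht => (hd t ht).differentiableAt.differentiableWithinAt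
    · rw [interior_Icc]
      intro t ht
      rw [(hd t ht).deriv]
      exact hg t ht
  exact hm (left_mem_Icc.2 hxy) (right_mem_Icc.2 hxy) hxy

theorem abs_rpow_sub_one_mul_sq {q : ℝ} (hq : 1 < q) (x : ℝ) :
    |x| ^ (q - 1) * x ^ 2 = |x| ^ (q + 1) := by
  rw [← sq_abs, ← Real.rpow_natCast, ← Real.rpow_add_of_nonneg (abs_nonneg x) (by linarith)
    (by norm_num)]
  congr 1
  push_cast
  ring

theorem mul_radialForce {lam q : ℝ} (hq : 1 < q) (x : ℝ) :
    x * radialForce lam q x = lam * (|x| ^ (q + 1) - x ^ 2) := by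
  rw [← abs_rpow_sub_one_mul_sq hq, radialForce]
  ring

theorem exists_sq_le_mul_abs_rpow_add {q η : ℝ} (hq : 1 < q) (hη : 0 < η) :
    ∃ C : ℝ, 0 ≤ C ∧ ∀ x : ℝ, x ^ 2 ≤ η * |x| ^ (q + 1) + C := by
  obtain ⟨A, hA⟩ := eventually_atTop.1
    ((tendsto_rpow_atTop (show 0 < q - 1 by linarith)).eventually_ge_atTop (1 / η))
  refine ⟨A ^ 2, sq_nonneg A, fun x => ?_⟩
  rw [← abs_rpow_sub_one_mul_sq hq]
  have hp : 0 ≤ |x| ^ (q - 1) := Real.rpow_nonneg (abs_nonneg x) _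
  rcases le_total A |x| with hx | hx
  · have h1 := hA _ hx
    rw [div_le_iff₀ hη] at h1
    nlinarith [sq_nonneg x, sq_nonneg A]
  · have h1 : x ^ 2 ≤ A ^ 2 := by
      rw [← sq_abs x]
      exact pow_le_pow_left₀ (abs_nonneg x) hx 2
    have : 0 ≤ η * (|x| ^ (q - 1) * x ^ 2) := by positivity
    linarith

theorem hasDerivAt_radialEnergy {h : ℝ → ℝ} {lam q T : ℝ} {u v : ℝ → ℝ} (hq : 1 < q)
    (hs : IsRadialSol_s6 h lam q T u v) {t : ℝ} (ht : t ∈ Ioo 0 T) :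
    HasDerivAt (fun t => radialEnergy lam q (u t) (v t)) (-(h t * v t ^ 2)) t := by
  have hu := hs.hasDerivAt_fst t ht
  have hv := hs.hasDerivAt_snd t ht
  have hp := (hasDerivAt_abs_rpow (u t) (p := q + 1) (by linarith)).comp t hu
  have hE := ((hv.pow 2).div_const 2).add
    (((hp.div_const (q + 1)).sub ((hu.pow 2).div_const 2)).const_mul lam)
  refine HasDerivAt.congr_deriv hE ?_
  have h1 : q + 1 - 2 = q - 1 := by ring
  have h2 : q + 1 ≠ 0 := by linarith
  rw [h1, radialForce]
  field_simp
  ring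

theorem IsRadialSol_s6.continuousOn_energy {h : ℝ → ℝ} {lam q T : ℝ} {u v : ℝ → ℝ} (hq : 1 < q)
    (hs : IsRadialSol_s6 h lam q T u v) :
    ContinuousOn (fun t => radialEnergy lam q (u t) (v t)) (Icc 0 T) := by
  unfold radialEnergy
  have hu := hs.continuousOn_fst
  have hv := hs.continuousOn_snd
  have hp : ContinuousOn (fun t => |u t| ^ (q + 1)) (Icc 0 T) :=
    hu.abs.rpow_const fun _ _ => Or.inr (by linarith)
  fun_prop

theorem IsRadialSol_s6.energy_le {h : ℝ → ℝ} {lam q T : ℝ} {u v : ℝ → ℝ} (hq : 1 < q)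
    (hs : IsRadialSol_s6 h lam q T u v) (hh : ∀ t ∈ Ioo 0 T, 0 < h t) {x y : ℝ}
    (hx : 0 ≤ x) (hxy : x ≤ y) (hy : y ≤ T) :
    radialEnergy lam q (u y) (v y) ≤ radialEnergy lam q (u x) (v x) := by
  have := le_of_hasDerivAt_nonneg (g := fun t => -radialEnergy lam q (u t) (v t)) hxy
    ((hs.continuousOn_energy hq).neg.mono (Icc_subset_Icc hx hy))
    (fun t ht => (hasDerivAt_radialEnergy hq hs ⟨hx.trans_lt ht.1, ht.2.trans_le hy⟩).neg)
    (fun t ht => by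
      have := hh t ⟨hx.trans_lt ht.1, ht.2.trans_le hy⟩
      rw [neg_neg]
      positivity)
  linarith

/-- A lower bound for the angular speed forces a zero on an interval longer than a half turn. -/
theorem exists_zero_of_angular_speed {u v w : ℝ → ℝ} {a b ω : ℝ} (hab : a < b)
    (hω : 0 < ω) (hωL : 8 * Real.pi ≤ ω * (b - a))
    (hu : ∀ t ∈ Ioo a b, HasDerivAt u (v t) t) (hv : ∀ t ∈ Ioo a b, HasDerivAt v (w t) t)
    (hS : ∀ t ∈ Ioo a b, (ω ^ 2 * u t ^ 2 + v t ^ 2) / 4 ≤ v t ^ 2 - u t * w t) :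
    ∃ t ∈ Ioo a b, u t = 0 := by
  by_contra! hne
  set g : ℝ → ℝ := fun t => -Real.arctan (v t / (ω * u t)) - ω / 4 * t
  have hg : ∀ t ∈ Ioo a b, HasDerivAt g
      (-(1 / (1 + (v t / (ω * u t)) ^ 2) *
        ((w t * (ω * u t) - v t * (ω * v t)) / (ω * u t) ^ 2)) - ω / 4 * 1) t := by
    intro t ht
    have hn : ω * u t ≠ 0 := mul_ne_zero hω.ne' (hne t ht)
    exact (((hv t ht).div ((hu t ht).const_mul ω) hn).arctan.neg).sub
      ((hasDerivAt_id t).const_mul (ω / 4))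
  have hsub : Icc (a + (b - a) / 4) (b - (b - a) / 4) ⊆ Ioo a b := fun t ht =>
    ⟨by linarith [ht.1], by linarith [ht.2]⟩
  have hmono := le_of_hasDerivAt_nonneg (g := g) (x := a + (b - a) / 4) (y := b - (b - a) / 4)
    (by linarith) (fun t ht => (hg t (hsub ht)).continuousAt.continuousWithinAt)
    (fun t ht => hg t (hsub (Ioo_subset_Icc_self ht)))
    (fun t ht => by
      have ht' := hsub (Ioo_subset_Icc_self ht)
      have hn := hne t ht'
      have hu2 : 0 < u t ^ 2 := by positivity
      have hden : 0 < ω ^ 2 * u t ^ 2 + v t ^ 2 := by positivity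
      have heq : -(1 / (1 + (v t / (ω * u t)) ^ 2) *
          ((w t * (ω * u t) - v t * (ω * v t)) / (ω * u t) ^ 2)) - ω / 4 * 1
          = ω * ((v t ^ 2 - u t * w t) / (ω ^ 2 * u t ^ 2 + v t ^ 2) - 1 / 4) := by
        have h1 : 1 + (v t / (ω * u t)) ^ 2 ≠ 0 := by positivity
        field_simp
        ring
      rw [heq]
      have := (le_div_iff₀ hden).2 (show 1 / 4 * (ω ^ 2 * u t ^ 2 + v t ^ 2) ≤
        v t ^ 2 - u t * w t by linarith [hS t ht'])
      exact mul_nonneg hω.le (by linarith))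
  simp only [g] at hmono
  have h1 := Real.neg_pi_div_two_lt_arctan
    (v (b - (b - a) / 4) / (ω * u (b - (b - a) / 4)))
  have h2 := Real.arctan_lt_pi_div_two
    (v (a + (b - a) / 4) / (ω * u (a + (b - a) / 4)))
  nlinarith

/-- Large energy forces a zero on every interval of a given length where `h` is bounded. -/
theorem exists_energy_forcing_zero {lam q H L : ℝ} (hlam : 0 < lam) (hq : 1 < q) (hL : 0 < L)
    (hH : 0 ≤ H) :
    ∃ K : ℝ, ∀ (h u v : ℝ → ℝ) (T a b : ℝ), IsRadialSol_s6 h lam q T u v → 0 ≤ a → b ≤ T →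
      L ≤ b - a → (∀ t ∈ Ioo a b, |h t| ≤ H) →
      (∀ t ∈ Ioo a b, K ≤ radialEnergy lam q (u t) (v t)) → ∃ t ∈ Ioo a b, u t = 0 := by
  obtain ⟨ω, hωH, hωL⟩ : ∃ ω : ℝ, H + 1 ≤ ω ∧ 8 * Real.pi / L ≤ ω :=
    ⟨max (H + 1) (8 * Real.pi / L), le_max_left _ _, le_max_right _ _⟩
  have hω : 0 < ω := by linarith
  obtain ⟨A, hA0, hA⟩ : ∃ A : ℝ, 0 ≤ A ∧ ∀ x, A ≤ x → ω ^ 2 / lam + 1 ≤ x ^ (q - 1) := by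
    obtain ⟨A, hA⟩ := eventually_atTop.1
      ((tendsto_rpow_atTop (show 0 < q - 1 by linarith)).eventually_ge_atTop (ω ^ 2 / lam + 1))
    exact ⟨max A 0, le_max_right _ _, fun x hx => hA x ((le_max_left _ _).trans hx)⟩
  refine ⟨lam * (A ^ (q + 1) / (q + 1)) + 2 * (lam + ω ^ 2) * A ^ 2, ?_⟩
  intro h u v T a b hs ha hb hLab hh hE
  have hsub : ∀ t ∈ Ioo a b, t ∈ Ioo 0 T := fun t ht =>
    ⟨ha.trans_lt ht.1, ht.2.trans_le hb⟩
  refine exists_zero_of_angular_speed (ω := ω) (by linarith) hω ?_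
    (fun t ht => hs.hasDerivAt_fst t (hsub t ht)) (fun t ht => hs.hasDerivAt_snd t (hsub t ht)) ?_
  · rw [div_le_iff₀ hL] at hωL
    nlinarith
  · intro t ht
    have hh1 : |h t * (u t * v t)| ≤ ω * |u t * v t| := by
      rw [abs_mul]
      exact mul_le_mul_of_nonneg_right ((hh t ht).trans (by linarith)) (abs_nonneg _)
    have hh2 := (abs_le.1 hh1).1
    have hh3 : ω * |u t * v t| ≤ (ω ^ 2 * u t ^ 2 + v t ^ 2) / 2 := by
      rw [abs_mul, ← sq_abs (u t), ← sq_abs (v t)]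
      nlinarith [sq_nonneg (ω * |u t| - |v t|)]
    have hf := mul_radialForce (lam := lam) hq (u t)
    have hf2 := abs_rpow_sub_one_mul_sq hq (u t)
    have hp : 0 ≤ |u t| ^ (q + 1) := Real.rpow_nonneg (abs_nonneg _) _
    have hid : v t ^ 2 - u t * (-(h t * v t) - radialForce lam q (u t)) =
        v t ^ 2 + h t * (u t * v t) + lam * (|u t| ^ (q + 1) - u t ^ 2) := by
      rw [← hf]
      ring
    rw [hid]
    rcases le_total A |u t| with hx | hx
    · have h1 : ω ^ 2 + lam ≤ lam * |u t| ^ (q - 1) := by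
        have := mul_le_mul_of_nonneg_left (hA _ hx) hlam.le
        have h2 : lam * (ω ^ 2 / lam + 1) = ω ^ 2 + lam := by field_simp
        linarith
      have h2 : ω ^ 2 * u t ^ 2 ≤ lam * (|u t| ^ (q + 1) - u t ^ 2) := by
        rw [← hf2]
        nlinarith [mul_le_mul_of_nonneg_right h1 (sq_nonneg (u t))]
      nlinarith [mul_nonneg (sq_nonneg ω) (sq_nonneg (u t)), sq_nonneg (v t)]
    · have h1 : |u t| ^ (q + 1) ≤ A ^ (q + 1) :=
        Real.rpow_le_rpow (abs_nonneg _) hx (by linarith)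
      have h2 : u t ^ 2 ≤ A ^ 2 := by
        rw [← sq_abs (u t)]
        exact pow_le_pow_left₀ (abs_nonneg _) hx 2
      have h3 := hE t ht
      rw [radialEnergy] at h3
      have h4 : lam * (|u t| ^ (q + 1) / (q + 1)) ≤ lam * (A ^ (q + 1) / (q + 1)) :=
        mul_le_mul_of_nonneg_left (div_le_div_of_nonneg_right h1 (by linarith)) hlam.le
      have h5 : (lam + ω ^ 2) * u t ^ 2 ≤ (lam + ω ^ 2) * A ^ 2 :=
        mul_le_mul_of_nonneg_left h2 (by positivity)
      nlinarith [mul_nonneg hlam.le hp, mul_nonneg hlam.le (sq_nonneg (u t))]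

theorem exists_primitive {h : ℝ → ℝ} {T s : ℝ} (hc : ContinuousOn h (Ioo 0 T))
    (hs : s ∈ Ioo 0 T) : ∃ P : ℝ → ℝ, P s = 0 ∧ ∀ t ∈ Ioo 0 T, HasDerivAt P (h t) t := by
  refine ⟨fun t => ∫ x in s..t, h x, intervalIntegral.integral_same, fun t ht => ?_⟩
  apply intervalIntegral.integral_hasDerivAt_right
  · exact (hc.mono (ordConnected_Ioo.uIcc_subset hs ht)).intervalIntegrable
  · exact hc.stronglyMeasurableAtFilter isOpen_Ioo t ht
  · exact hc.continuousAt (isOpen_Ioo.mem_nhds ht)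

/-- The weight `exp (∫ h)` is at least a power, when `t * h t ≤ M`. -/
theorem div_rpow_le_exp {h P : ℝ → ℝ} {s T M : ℝ} (hs : s ∈ Ioo 0 T) (hPs : P s = 0)
    (hP : ∀ t ∈ Ioo 0 T, HasDerivAt P (h t) t) (hM : ∀ t ∈ Ioc 0 s, t * h t ≤ M) {t : ℝ}
    (ht : t ∈ Ioc 0 s) : (t / s) ^ M ≤ Real.exp (P t) := by
  have hsub : ∀ x ∈ Icc t s, x ∈ Ioo 0 T := fun x hx =>
    ⟨ht.1.trans_le hx.1, hx.2.trans_lt hs.2⟩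
  have hd : ∀ x ∈ Icc t s,
      HasDerivAt (fun x => M * Real.log x - P x) (M * x⁻¹ - h x) x := fun x hx =>
    ((Real.hasDerivAt_log (hsub x hx).1.ne').const_mul M).sub (hP x (hsub x hx))
  have hmono := le_of_hasDerivAt_nonneg ht.2
    (fun x hx => (hd x hx).continuousAt.continuousWithinAt)
    (fun x hx => hd x (Ioo_subset_Icc_self hx))
    (fun x hx => by
      have hx0 := (hsub x (Ioo_subset_Icc_self hx)).1
      have h1 := hM x ⟨hx0, hx.2.le⟩
      rw [← div_eq_mul_inv, sub_nonneg, le_div_iff₀ hx0]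
      linarith)
  rw [Real.rpow_def_of_pos (div_pos ht.1 hs.1), Real.exp_le_exp,
    Real.log_div ht.1.ne' hs.1.ne']
  simp only [hPs] at hmono
  linarith

/-- Derivative of the weighted Pohozaev functional. -/
theorem hasDerivAt_pohozaev {h P : ℝ → ℝ} {lam q T a : ℝ} {u v : ℝ → ℝ} (hq : 1 < q)
    (hs : IsRadialSol_s6 h lam q T u v) {t : ℝ} (ht : t ∈ Ioo 0 T) (hP : HasDerivAt P (h t) t) :
    HasDerivAt
      (fun t => Real.exp (P t) * (t * radialEnergy lam q (u t) (v t) + a * (u t * v t)))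
      (Real.exp (P t) * (v t ^ 2 * ((1 - t * h t) / 2 + a)
        + (1 + t * h t) * (lam * (|u t| ^ (q + 1) / (q + 1) - u t ^ 2 / 2))
        - a * (lam * (|u t| ^ (q + 1) - u t ^ 2)))) t := by
  have hE := hasDerivAt_radialEnergy hq hs ht
  have hR := ((hasDerivAt_id t).mul hE).add
    (((hs.hasDerivAt_fst t ht).mul (hs.hasDerivAt_snd t ht)).const_mul a)
  refine HasDerivAt.congr_deriv (hP.exp.mul hR) ?_
  rw [← mul_radialForce hq, radialEnergy]
  simp only [id_eq]
  ring

theorem exists_pohozaev_bounds {lam q N : ℝ} (hlam : 0 < lam) (hq : 1 < q) (hN : 1 ≤ N)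
    (hsub : (q - 1) * (N - 1) < 4) :
    ∃ a η c C : ℝ, 0 ≤ a ∧ 0 < η ∧ 0 < c ∧ 0 ≤ C ∧ (q - 1) * (N + η + 1) < 2 * (q + 1) ∧
      ∀ x v τ : ℝ, |τ - N| ≤ η → c * |x| ^ (q + 1) - C ≤
        v ^ 2 * ((1 - τ) / 2 + a) + (1 + τ) * (lam * (|x| ^ (q + 1) / (q + 1) - x ^ 2 / 2))
          - a * (lam * (|x| ^ (q + 1) - x ^ 2)) := by
  have hq1 : 0 < q + 1 := by linarith
  set g := (4 - (q - 1) * (N - 1)) / (2 * (q + 1)) with hg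
  have hg0 : 0 < g := div_pos (by linarith) (by linarith)
  have hgq : g * (2 * (q + 1)) = 4 - (q - 1) * (N - 1) := by
    rw [hg]
    field_simp
  have hB : 0 < 1 + N + g := by linarith
  obtain ⟨C, hC0, hC⟩ := exists_sq_le_mul_abs_rpow_add hq
    (show 0 < g / (4 * (1 + N + g)) by positivity)
  refine ⟨(N - 1) / 2 + g / 2, g / 2, lam * g / 8, lam * (1 + N + g) / 2 * C, by linarith,
    by linarith, by positivity, by positivity, by nlinarith, ?_⟩
  intro x v τ hτ
  obtain ⟨hτ1, hτ2⟩ := abs_le.1 hτ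
  have hy : 0 ≤ |x| ^ (q + 1) := Real.rpow_nonneg (abs_nonneg x) _
  set y := |x| ^ (q + 1) with hyd
  have h1 : 0 ≤ v ^ 2 * ((1 - τ) / 2 + ((N - 1) / 2 + g / 2)) :=
    mul_nonneg (sq_nonneg v) (by linarith)
  have h2 : g / 4 + ((N - 1) / 2 + g / 2) ≤ (1 + τ) / (q + 1) := by
    rw [le_div_iff₀ hq1]
    nlinarith
  have h3 : (g / 4 + ((N - 1) / 2 + g / 2)) * y ≤ (1 + τ) / (q + 1) * y :=
    mul_le_mul_of_nonneg_right h2 hy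
  have h4 : ((1 + τ) / 2 - ((N - 1) / 2 + g / 2)) * x ^ 2 ≤ (1 + N + g) / 2 * x ^ 2 :=
    mul_le_mul_of_nonneg_right (by linarith) (sq_nonneg x)
  have h5 : (1 + N + g) / 2 * x ^ 2 ≤ g / 8 * y + (1 + N + g) / 2 * C := by
    calc (1 + N + g) / 2 * x ^ 2
        ≤ (1 + N + g) / 2 * (g / (4 * (1 + N + g)) * y + C) :=
          mul_le_mul_of_nonneg_left (hC x) (by linarith)
      _ = _ := by
          field_simp
          ring
  have h6 : g / 8 * y - (1 + N + g) / 2 * C ≤ (1 + τ) / (q + 1) * y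
      - ((N - 1) / 2 + g / 2) * y - ((1 + τ) / 2 - ((N - 1) / 2 + g / 2)) * x ^ 2 := by
    linarith
  have h7 := mul_le_mul_of_nonneg_left h6 hlam.le
  have h8 : (1 + τ) * (lam * (y / (q + 1) - x ^ 2 / 2))
          - ((N - 1) / 2 + g / 2) * (lam * (y - x ^ 2)) = lam * ((1 + τ) / (q + 1) * y
      - ((N - 1) / 2 + g / 2) * y - ((1 + τ) / 2 - ((N - 1) / 2 + g / 2)) * x ^ 2) := by
    ring
  linarith

theorem exists_sq_add_sq_le_energy {lam q : ℝ} (hlam : 0 < lam) (hq : 1 < q) :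
    ∃ C : ℝ, 0 ≤ C ∧ ∀ x v : ℝ,
      v ^ 2 / 2 + lam / 2 * x ^ 2 ≤ radialEnergy lam q x v + C := by
  obtain ⟨C, hC0, hC⟩ := exists_sq_le_mul_abs_rpow_add hq (show 0 < 1 / (q + 1) by
    have : 0 < q + 1 := by linarith
    positivity)
  refine ⟨lam * C, by positivity, fun x v => ?_⟩
  have h1 := mul_le_mul_of_nonneg_left (hC x) hlam.le
  rw [radialEnergy]
  have h2 : 1 / (q + 1) * |x| ^ (q + 1) = |x| ^ (q + 1) / (q + 1) := by ring
  rw [h2] at h1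
  linarith

theorem IsRadialSol_s6.abs_snd_le {h : ℝ → ℝ} {lam q T C α : ℝ} {u v : ℝ → ℝ} (hlam : 0 < lam)
    (hq : 1 < q) (hs : IsRadialSol_s6 h lam q T u v) (hh : ∀ t ∈ Ioo 0 T, 0 < h t) (hC0 : 0 ≤ C)
    (hC : ∀ x v : ℝ, v ^ 2 / 2 + lam / 2 * x ^ 2 ≤ radialEnergy lam q x v + C)
    (hα : 1 ≤ α) (hu0 : u 0 = α) (hv0 : v 0 = 0) {t : ℝ} (ht : t ∈ Icc 0 T) :
    |v t| ≤ √(2 * (lam + C)) * α ^ ((q + 1) / 2) := by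
  have hα0 : 0 ≤ α := by linarith
  have h1 := hs.energy_le hq hh le_rfl ht.1 ht.2
  have h2 := hC (u t) (v t)
  have h3 : radialEnergy lam q (u 0) (v 0) ≤ lam * α ^ (q + 1) := by
    rw [hu0, hv0, radialEnergy, abs_of_nonneg hα0]
    have h4 : α ^ (q + 1) / (q + 1) ≤ α ^ (q + 1) :=
      div_le_self (Real.rpow_nonneg hα0 _) (by linarith)
    nlinarith [mul_le_mul_of_nonneg_left h4 hlam.le, mul_nonneg hlam.le (sq_nonneg α)]
  have h5 : 1 ≤ α ^ (q + 1) := Real.one_le_rpow hα (by linarith)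
  have h6 : (√(2 * (lam + C)) * α ^ ((q + 1) / 2)) ^ 2 = 2 * (lam + C) * α ^ (q + 1) := by
    rw [mul_pow, Real.sq_sqrt (by positivity), ← Real.rpow_mul_natCast hα0]
    norm_num
  apply abs_le_of_sq_le_sq _ (by positivity)
  rw [h6]
  nlinarith [mul_nonneg hlam.le (sq_nonneg (u t)), mul_le_mul_of_nonneg_left h5 hC0]

theorem IsRadialSol_s6.sub_mul_le_fst {h : ℝ → ℝ} {lam q T B : ℝ} {u v : ℝ → ℝ}
    (hs : IsRadialSol_s6 h lam q T u v) (hB : ∀ t ∈ Icc 0 T, |v t| ≤ B) {t : ℝ}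
    (ht : t ∈ Icc 0 T) : u 0 - B * t ≤ u t := by
  have := le_of_hasDerivAt_nonneg (g := fun t => u t + B * t) (g' := fun t => v t + B * 1) ht.1
    ((hs.continuousOn_fst.mono (Icc_subset_Icc le_rfl ht.2)).add (by fun_prop))
    (fun x hx => (hs.hasDerivAt_fst x ⟨hx.1, hx.2.trans_le ht.2⟩).add
      ((hasDerivAt_id x).const_mul B))
    (fun x hx => by
      have := (abs_le.1 (hB x ⟨hx.1.le, hx.2.le.trans ht.2⟩)).1
      linarith)
  simp only [mul_zero, add_zero] at this
  linarith

theorem IsRadialSol_s6.tendsto_pohozaev {h P : ℝ → ℝ} {lam q T s a : ℝ} {u v : ℝ → ℝ} (hq : 1 < q)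
    (hsol : IsRadialSol_s6 h lam q T u v) (hv0 : v 0 = 0) (hs : s ∈ Ioo 0 T)
    (hP : ∀ t ∈ Ioc 0 s, P t ≤ 0) :
    Tendsto (fun t => Real.exp (P t) * (t * radialEnergy lam q (u t) (v t) + a * (u t * v t)))
      (nhdsWithin 0 (Ioi 0)) (nhds 0) := by
  have hT : 0 < T := hs.1.trans hs.2
  have hc : ContinuousOn (fun t => t * radialEnergy lam q (u t) (v t) + a * (u t * v t))
      (Icc 0 T) := by
    have h1 := hsol.continuousOn_energy hq
    have h2 := hsol.continuousOn_fst
    have h3 := hsol.continuousOn_snd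
    fun_prop
  have hl : Tendsto (fun t => t * radialEnergy lam q (u t) (v t) + a * (u t * v t))
      (nhdsWithin 0 (Ioi 0)) (nhds 0) := by
    have := (hc 0 (left_mem_Icc.2 hT.le)).tendsto
    simp only [hv0, zero_mul, mul_zero, add_zero] at this
    refine this.mono_left (nhdsWithin_le_of_mem ?_)
    exact Icc_mem_nhdsGT hT
  refine squeeze_zero_norm' ?_ (tendsto_zero_iff_norm_tendsto_zero.1 hl)
  filter_upwards [Ioc_mem_nhdsGT hs.1] with t ht
  rw [norm_mul, Real.norm_of_nonneg (Real.exp_pos _).le]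
  exact mul_le_of_le_one_left (norm_nonneg _) (Real.exp_le_one_iff.2 (hP t ht))

/-- A function vanishing at `0⁺` whose derivative dominates that of a power dominates the power. -/
theorem mul_rpow_le_of_deriv_ge {G G' : ℝ → ℝ} {τ B M : ℝ} (hM : 0 < M + 1) (hτ : 0 < τ)
    (hG : ∀ y ∈ Ioc 0 τ, HasDerivAt G (G' y) y)
    (hB : ∀ y ∈ Ioc 0 τ, B * ((M + 1) * y ^ M) ≤ G' y)
    (hlim : Tendsto G (nhdsWithin 0 (Ioi 0)) (nhds 0)) : B * τ ^ (M + 1) ≤ G τ := by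
  have hmono : ∀ x ∈ Ioc 0 τ, G x - B * x ^ (M + 1) ≤ G τ - B * τ ^ (M + 1) := fun x hx => by
    have hsub : ∀ y ∈ Icc x τ, y ∈ Ioc 0 τ := fun y hy => ⟨hx.1.trans_le hy.1, hy.2⟩
    have hd : ∀ y ∈ Icc x τ, HasDerivAt (fun t => G t - B * t ^ (M + 1))
        (G' y - B * ((M + 1) * y ^ (M + 1 - 1))) y :=
      fun y hy => (hG y (hsub y hy)).sub ((Real.hasDerivAt_rpow_const
        (Or.inl (hsub y hy).1.ne')).const_mul _)
    refine le_of_hasDerivAt_nonneg (g := fun t => G t - B * t ^ (M + 1)) hx.2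
      (fun y hy => (hd y hy).continuousAt.continuousWithinAt)
      (fun y hy => hd y (Ioo_subset_Icc_self hy)) (fun y hy => ?_)
    rw [add_sub_cancel_right, sub_nonneg]
    exact hB y (hsub y (Ioo_subset_Icc_self hy))
  have hk0 : Tendsto (fun t : ℝ => B * t ^ (M + 1)) (nhdsWithin 0 (Ioi 0)) (nhds 0) := by
    have h1 : ContinuousAt (fun t : ℝ => B * t ^ (M + 1)) 0 :=
      (Real.continuousAt_rpow_const 0 (M + 1) (Or.inr hM.le)).const_mul _
    have h2 := h1.tendsto
    simp only [Real.zero_rpow hM.ne', mul_zero] at h2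
    exact h2.mono_left nhdsWithin_le_nhds
  have hlim' := hlim.sub hk0
  rw [sub_zero] at hlim'
  have := le_of_tendsto hlim' (by
    filter_upwards [Ioc_mem_nhdsGT hτ] with x hx
    exact hmono x hx)
  linarith

theorem mul_le_energy_add {lam E D x v : ℝ} (hlam : 0 < lam)
    (hD : v ^ 2 / 2 + lam / 2 * x ^ 2 ≤ E + D) : x * v ≤ (1 + 1 / lam) * (E + D) := by
  have h2 : v ^ 2 / 2 ≤ E + D := by
    have : 0 ≤ lam / 2 * x ^ 2 := by positivity
    linarith
  have h3 : x ^ 2 / 2 ≤ 1 / lam * (E + D) := by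
    rw [one_div, inv_mul_eq_div, le_div_iff₀ hlam]
    nlinarith [sq_nonneg v]
  nlinarith [sq_nonneg (x - v)]

theorem mul_half_mul_rpow_eq {α V r : ℝ} (hα : 0 < α) (hV : 0 < V) :
    V * α ^ ((r + 1) / 2) * (α ^ (-((r - 1) / 2)) / (2 * V)) = α / 2 := by
  have h3 : α ^ ((r + 1) / 2) * α ^ (-((r - 1) / 2)) = α := by
    rw [← Real.rpow_add hα]
    convert Real.rpow_one α using 2
    ring
  field_simp
  linarith

theorem mul_rpow_mul_scaled_rpow {α W r b p e B : ℝ} (hα : 0 < α) (hW : 0 < W) :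
    B * α ^ r / b / p * (α ^ (-e) / W) ^ p = B / b / p / W ^ p * α ^ (r - e * p) := by
  rw [Real.div_rpow (Real.rpow_nonneg hα.le _) hW.le, ← Real.rpow_mul hα.le, neg_mul,
    sub_eq_add_neg, Real.rpow_add hα r]
  ring

/-- At a fixed small time, the energy tends to infinity with the initial height. -/
theorem exists_height_energy_ge {h : ℝ → ℝ} {lam q N a η c C s T : ℝ} (hlam : 0 < lam)
    (hq : 1 < q) (hN : 1 ≤ N) (hhc : ContinuousOn h (Ioo 0 T)) (hh : ∀ t ∈ Ioo 0 T, 0 < h t)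
    (hs : s ∈ Ioo 0 T) (ha : 0 ≤ a) (hη : 0 < η) (hc : 0 < c) (hC : 0 ≤ C)
    (hexp : (q - 1) * (N + η + 1) < 2 * (q + 1))
    (hbound : ∀ x v τ : ℝ, |τ - N| ≤ η → c * |x| ^ (q + 1) - C ≤
        v ^ 2 * ((1 - τ) / 2 + a) + (1 + τ) * (lam * (|x| ^ (q + 1) / (q + 1) - x ^ 2 / 2))
          - a * (lam * (|x| ^ (q + 1) - x ^ 2)))
    (hN' : ∀ t ∈ Ioc 0 s, |t * h t - N| ≤ η) (K : ℝ) :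
    ∃ A : ℝ, ∀ α : ℝ, A ≤ α → ∀ u v : ℝ → ℝ, IsRadialSol_s6 h lam q T u v → u 0 = α → v 0 = 0 →
      K ≤ radialEnergy lam q (u s) (v s) := by
  obtain ⟨D, hD0, hD⟩ := exists_sq_add_sq_le_energy hlam hq
  obtain ⟨P, hPs, hP⟩ := exists_primitive hhc hs
  have hP0 : ∀ t ∈ Ioc 0 s, P t ≤ 0 := fun t ht => by
    rw [← hPs]
    have hsub : ∀ x ∈ Icc t s, x ∈ Ioo 0 T := fun x hx =>
      ⟨ht.1.trans_le hx.1, hx.2.trans_lt hs.2⟩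
    exact le_of_hasDerivAt_nonneg ht.2
      (fun x hx => (hP x (hsub x hx)).continuousAt.continuousWithinAt)
      (fun x hx => hP x (hsub x (Ioo_subset_Icc_self hx)))
      (fun x hx => (hh x (hsub x (Ioo_subset_Icc_self hx))).le)
  set M := N + η with hM
  have hM0 : 0 < M + 1 := by linarith
  set V := √(2 * (lam + D)) with hV
  have hV0 : 0 < V := Real.sqrt_pos.2 (by positivity)
  set c₁ := c * (1 / 2) ^ (q + 1) / 2 with hc₁
  have hc₁0 : 0 < c₁ := by positivity
  set c₂ := c₁ / s ^ M / (M + 1) / (2 * V) ^ (M + 1) with hc₂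
  have hs0 := hs.1
  have hc₂0 : 0 < c₂ := by positivity
  set R := (s + a * (1 + 1 / lam)) * K + a * (1 + 1 / lam) * D + C * s with hR
  have hev : ∀ᶠ α : ℝ in atTop, 1 ≤ α ∧ C / c₁ ≤ α ^ (q + 1) ∧
      α ^ (-((q - 1) / 2)) < 2 * V * s ∧
      R / c₂ < α ^ ((q + 1) - (q - 1) / 2 * (M + 1)) := by
    refine (eventually_ge_atTop 1).and (Eventually.and ?_ (Eventually.and ?_ ?_))
    · exact (tendsto_rpow_atTop (by linarith)).eventually_ge_atTop _
    · exact (tendsto_rpow_neg_atTop (by linarith)).eventually_lt_const (by positivity)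
    · exact (tendsto_rpow_atTop (by linarith)).eventually_gt_atTop _
  obtain ⟨A, hA⟩ := eventually_atTop.1 hev
  refine ⟨A, fun α hα u v hsol hu0 hv0 => ?_⟩
  obtain ⟨hα1, hαC, hατ, hαR⟩ := hA α hα
  have hα0 : 0 < α := by linarith
  have hspeed : ∀ t ∈ Icc 0 T, |v t| ≤ V * α ^ ((q + 1) / 2) := fun t ht =>
    hsol.abs_snd_le hlam hq hh hD0 hD hα1 hu0 hv0 ht
  set τ := α ^ (-((q - 1) / 2)) / (2 * V) with hτ
  have hτ0 : 0 < τ := by positivity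
  have hτs : τ ≤ s := by
    rw [hτ, div_le_iff₀ (by positivity)]
    linarith
  have hhalf : ∀ t ∈ Icc 0 τ, α / 2 ≤ u t := fun t ht => by
    have h1 := hsol.sub_mul_le_fst hspeed (t := t) ⟨ht.1, (ht.2.trans hτs).trans hs.2.le⟩
    have h2 : V * α ^ ((q + 1) / 2) * τ = α / 2 := mul_half_mul_rpow_eq hα0 hV0
    have h4 : V * α ^ ((q + 1) / 2) * t ≤ V * α ^ ((q + 1) / 2) * τ :=
      mul_le_mul_of_nonneg_left ht.2 (by positivity)
    linarith
  set G : ℝ → ℝ := fun t =>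
    Real.exp (P t) * (t * radialEnergy lam q (u t) (v t) + a * (u t * v t)) with hG
  have hGd : ∀ t ∈ Ioc 0 s, ∃ g', HasDerivAt G g' t ∧
      Real.exp (P t) * (c * |u t| ^ (q + 1) - C) ≤ g' := fun t ht => by
    have htT : t ∈ Ioo 0 T := ⟨ht.1, ht.2.trans_lt hs.2⟩
    exact ⟨_, hasDerivAt_pohozaev hq hsol htT (hP t htT),
      mul_le_mul_of_nonneg_left (hbound _ _ _ (hN' t ht)) (Real.exp_pos _).le⟩
  choose! G' hG' hGb using hGd
  have hlate : G τ + C * τ ≤ G s + C * s := by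
    have hsub : ∀ x ∈ Icc τ s, x ∈ Ioc 0 s := fun x hx => ⟨hτ0.trans_le hx.1, hx.2⟩
    have hd : ∀ x ∈ Icc τ s, HasDerivAt (fun t => G t + C * t) (G' x + C * 1) x := fun x hx =>
      (hG' x (hsub x hx)).add ((hasDerivAt_id x).const_mul C)
    refine le_of_hasDerivAt_nonneg hτs
      (fun x hx => (hd x hx).continuousAt.continuousWithinAt)
      (fun x hx => hd x (Ioo_subset_Icc_self hx)) (fun x hx => ?_)
    have hx' := hsub x (Ioo_subset_Icc_self hx)
    have h1 := hGb x hx'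
    have h2 := Real.exp_le_one_iff.2 (hP0 x hx')
    have h3 := mul_nonneg hc.le (Real.rpow_nonneg (abs_nonneg (u x)) (q + 1))
    nlinarith [mul_nonneg (Real.exp_pos (P x)).le h3]
  have hearly : c₁ * α ^ (q + 1) / s ^ M / (M + 1) * τ ^ (M + 1) ≤ G τ := by
    refine mul_rpow_le_of_deriv_ge hM0 hτ0 (fun y hy => hG' y ⟨hy.1, hy.2.trans hτs⟩)
      (fun y hy => ?_) (hsol.tendsto_pohozaev hq hv0 hs hP0)
    have hy' : y ∈ Ioc 0 s := ⟨hy.1, hy.2.trans hτs⟩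
    have h1 := hGb y hy'
    have h2 := div_rpow_le_exp (M := M) hs hPs hP
      (fun t ht => by linarith [(abs_le.1 (hN' t ht)).2]) hy'
    have h3 : α / 2 ≤ |u y| :=
      (hhalf y ⟨hy.1.le, hy.2⟩).trans (le_abs_self _)
    have h4 : (α / 2) ^ (q + 1) ≤ |u y| ^ (q + 1) :=
      Real.rpow_le_rpow (by positivity) h3 (by linarith)
    have h5 : c₁ * α ^ (q + 1) ≤ c * |u y| ^ (q + 1) - C := by
      rw [div_le_iff₀ hc₁0] at hαC
      have h6 : c * (α / 2) ^ (q + 1) = 2 * (c₁ * α ^ (q + 1)) := by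
        rw [hc₁, div_eq_mul_one_div α 2, Real.mul_rpow hα0.le (by norm_num)]
        ring
      have h7 := mul_le_mul_of_nonneg_left h4 hc.le
      linarith
    have h8 : c₁ * α ^ (q + 1) / s ^ M / (M + 1) * ((M + 1) * y ^ M) =
        (y / s) ^ M * (c₁ * α ^ (q + 1)) := by
      rw [Real.div_rpow hy'.1.le hs0.le]
      field_simp
    rw [h8]
    exact (mul_le_mul h2 h5 (by positivity) (Real.exp_pos _).le).trans h1
  rw [hτ, mul_rpow_mul_scaled_rpow hα0 (by positivity)] at hearly
  rw [div_lt_iff₀ hc₂0, mul_comm] at hαR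
  have hGs : G s = s * radialEnergy lam q (u s) (v s) + a * (u s * v s) := by
    simp only [hG, hPs, Real.exp_zero, one_mul]
  have huv := mul_le_energy_add hlam (hD (u s) (v s))
  by_contra! hlt
  have h1 := mul_le_mul_of_nonneg_left huv ha
  have h2 : 0 < 1 + 1 / lam := by positivity
  have h3 : (s + a * (1 + 1 / lam)) * radialEnergy lam q (u s) (v s) ≤
      (s + a * (1 + 1 / lam)) * K := mul_le_mul_of_nonneg_left hlt.le (by positivity)
  have h4 : 0 ≤ C * τ := by positivity
  linarith

theorem SolOn.isRadialSol_s6 {h : ℝ → ℝ} {lam q T : ℝ} {u u' u'' : ℝ → ℝ}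
    (hs : SolOn h lam q (Icc 0 T) (Ioc 0 T) u u' u'') : IsRadialSol_s6 h lam q T u u' := by
  obtain ⟨h1, h2, h3, -, h5⟩ := hs
  refine ⟨fun t ht => (h1 t ht).continuousWithinAt, h2,
    fun t ht => (h1 t (Ioo_subset_Icc_self ht)).hasDerivAt (Icc_mem_nhds ht.1 ht.2),
    fun t ht => ?_⟩
  refine ((h3 t (Ioo_subset_Ioc_self ht)).hasDerivAt (Ioc_mem_nhds ht.1 ht.2)).congr_deriv ?_
  have := h5 t (Ioo_subset_Ioc_self ht)
  rw [radialForce]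
  linarith

/-- Zeros in consecutive disjoint intervals give a finite set of zeros of the given size. -/
theorem exists_finset_zeros {u : ℝ → ℝ} {s L : ℝ} (hL : 0 < L) (k : ℕ)
    (hz : ∀ i < k, ∃ t ∈ Ioo (s + i * L) (s + (i + 1) * L), u t = 0) :
    ∃ Z : Finset ℝ, (∀ t ∈ Z, t ∈ Ioo s (s + k * L) ∧ u t = 0) ∧ k ≤ Z.card := by
  choose! z hz hz0 using hz
  have hinj : ∀ i < k, ∀ j < k, i < j → z i < z j := fun i hi j hj hij => by
    have h1 : ((i : ℝ) + 1) ≤ j := by exact_mod_cast hij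
    have := mul_le_mul_of_nonneg_right h1 hL.le
    linarith [(hz i hi).2, (hz j hj).1]
  refine ⟨(Finset.range k).image z, fun t ht => ?_, ?_⟩
  · obtain ⟨i, hi, rfl⟩ := Finset.mem_image.1 ht
    rw [Finset.mem_range] at hi
    have h1 : ((i : ℝ) + 1) ≤ k := by exact_mod_cast hi
    have h2 := mul_le_mul_of_nonneg_right h1 hL.le
    have h3 : 0 ≤ (i : ℝ) * L := by positivity
    exact ⟨⟨by linarith [(hz i hi).1], by linarith [(hz i hi).2]⟩, hz0 i hi⟩
  · rw [Finset.card_image_of_injOn, Finset.card_range]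
    intro i hi j hj hij
    rw [Finset.coe_range, mem_Iio] at hi hj
    rcases lt_trichotomy i j with hlt | heq | hlt
    · exact absurd hij (hinj i hi j hj hlt).ne
    · exact heq
    · exact absurd hij (hinj j hj i hi hlt).ne'

theorem exists_height_many_zeros {h : ℝ → ℝ} {lam q N T ε : ℝ} (hlam : 0 < lam) (hq : 1 < q)
    (hN : 1 ≤ N) (hsub : (q - 1) * (N - 1) < 4) (hhc : ContinuousOn h (Ioo 0 T))
    (hh : ∀ t ∈ Ioo 0 T, 0 < h t)
    (hlim : Tendsto (fun t => t * h t) (nhdsWithin 0 (Ioi 0)) (nhds N))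
    (hε : 0 < ε) (hεT : ε ≤ T) {k : ℕ} (hk : 0 < k) :
    ∃ A : ℝ, ∀ α : ℝ, A ≤ α → ∀ u v : ℝ → ℝ, IsRadialSol_s6 h lam q T u v → u 0 = α → v 0 = 0 →
      ∃ Z : Finset ℝ, (∀ t ∈ Z, t ∈ Ioo 0 ε ∧ u t = 0) ∧ k ≤ Z.card := by
  obtain ⟨a, η, c, C, ha, hη, hc, hC, hexp, hbound⟩ := exists_pohozaev_bounds hlam hq hN hsub
  obtain ⟨δ, hδ0, hδ⟩ := mem_nhdsGT_iff_exists_Ioo_subset.1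
    (hlim (Metric.closedBall_mem_nhds N hη))
  have hm : 0 < min δ ε := lt_min hδ0 hε
  set s := min δ ε / 2 with hs
  have hs0 : 0 < s := by positivity
  have hsδ : s < δ := by linarith [min_le_left δ ε]
  have hsε : s < ε := by linarith [min_le_right δ ε]
  have hN' : ∀ t ∈ Ioc 0 s, |t * h t - N| ≤ η := fun t ht => by
    have := hδ (show t ∈ Ioo 0 δ from ⟨ht.1, ht.2.trans_lt hsδ⟩)
    rwa [mem_preimage, Metric.mem_closedBall, Real.dist_eq] at this
  have hk' : (0 : ℝ) < k := by exact_mod_cast hk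
  set L := s / 2 / k with hL
  have hL0 : 0 < L := by positivity
  have hLk : k * L = s / 2 := by
    rw [hL]
    field_simp
  obtain ⟨K, hK⟩ := exists_energy_forcing_zero (H := 2 * (N + η) / s) hlam hq hL0
    (by positivity)
  obtain ⟨A, hA⟩ := exists_height_energy_ge hlam hq hN hhc hh ⟨hs0, hsε.trans_le hεT⟩ ha hη hc
    hC hexp hbound hN' K
  refine ⟨A, fun α hα u v hsol hu0 hv0 => ?_⟩
  obtain ⟨Z, hZ, hcard⟩ := exists_finset_zeros (u := u) (s := s / 2) hL0 k (fun i hi => by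
    have h0 : 0 ≤ (i : ℝ) * L := by positivity
    have h1 : ((i : ℝ) + 1) * L ≤ k * L :=
      mul_le_mul_of_nonneg_right (by exact_mod_cast hi) hL0.le
    refine hK h u v T _ _ hsol (by linarith) (by linarith) (by linarith) ?_ ?_
    · intro t ht
      have ht1 : s / 2 < t := by linarith [ht.1]
      have ht2 : t < s := by linarith [ht.2]
      have ht0 : 0 < t := by linarith
      have hpos := hh t ⟨ht0, by linarith⟩
      have h2 := (abs_le.1 (hN' t ⟨ht0, ht2.le⟩)).2
      rw [abs_of_pos hpos, le_div_iff₀ hs0]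
      nlinarith
    · intro t ht
      exact (hA α hα u v hsol hu0 hv0).trans
        (hsol.energy_le hq hh (by linarith [ht.1]) (by linarith [ht.2]) (by linarith)))
  refine ⟨Z, fun t ht => ⟨⟨?_, ?_⟩, (hZ t ht).2⟩, hcard⟩
  · linarith [(hZ t ht).1.1]
  · linarith [(hZ t ht).1.2]

theorem stmt_6
    (d lam : ℝ) (hd : 0 < d) (hlam : 0 < lam)
    (n m₁ m₂ : ℤ) (hn : 3 ≤ n)
    (hm₁0 : 0 ≤ m₁) (hm₁n : m₁ ≤ n - 2) (hm₂0 : 0 ≤ m₂) (hm₂n : m₂ ≤ n - 2)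
    (h : ℝ → ℝ) (hC1 : ContDiffOn ℝ 1 h (Set.Ioo 0 d))
    (hder : ∀ t ∈ Set.Ioo 0 d, deriv h t < 0)
    (hlim0 : Filter.Tendsto (fun t => t * h t) (nhdsWithin 0 (Set.Ioi 0))
      (nhds ((n : ℝ) - (m₁ : ℝ) - 1)))
    (hlimd : Filter.Tendsto (fun t => (t - d) * h t) (nhdsWithin d (Set.Iio d))
      (nhds ((n : ℝ) - (m₂ : ℝ) - 1)))
    (q : ℝ) (hq1 : 1 < q)
    (hqsub : min m₁ m₂ < n - 2 →
      q < ((n : ℝ) - (min m₁ m₂ : ℝ) + 2) / ((n : ℝ) - (min m₁ m₂ : ℝ) - 2))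
    (t₀ : ℝ) (ht₀ : t₀ ∈ Set.Ioo 0 d)
    (hpos : ∀ t ∈ Set.Ioo 0 t₀, 0 < h t) (hneg : ∀ t ∈ Set.Ioo t₀ d, h t < 0)
    (U U' U'' : ℝ → ℝ → ℝ)
    (hU : ∀ α : ℝ, SolOn h lam q (Set.Icc 0 t₀) (Set.Ioc 0 t₀) (U α) (U' α) (U'' α) ∧
      U α 0 = α ∧ U' α 0 = 0)
    (hUuniq : ∀ α : ℝ, ∀ u u' u'' : ℝ → ℝ,
      SolOn h lam q (Set.Icc 0 t₀) (Set.Ioc 0 t₀) u u' u'' → u 0 = α → u' 0 = 0 →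
      ∀ t ∈ Set.Icc 0 t₀, u t = U α t ∧ u' t = U' α t)
    (ε : ℝ) (hε0 : 0 < ε) (hεt : ε ≤ t₀) (k : ℕ) (hk : 0 < k) :
    ∃ αk : ℝ, 0 < αk ∧ ∀ α : ℝ, αk ≤ α →
      ∃ s : Finset ℝ, (∀ t ∈ s, t ∈ Set.Ioo 0 ε ∧ U α t = 0) ∧ k ≤ s.card := by
  have hN : (1 : ℝ) ≤ (n : ℝ) - (m₁ : ℝ) - 1 := by
    have : (m₁ : ℝ) ≤ n - 2 := by exact_mod_cast hm₁n
    linarith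
  have hsub : (q - 1) * ((n : ℝ) - (m₁ : ℝ) - 1 - 1) < 4 := by
    rcases hm₁n.lt_or_eq with hlt | heq
    · have hmin := min_le_left (m₁ : ℝ) (m₂ : ℝ)
      have hlt' : (m₁ : ℝ) < n - 2 := by exact_mod_cast hlt
      have h1 := hqsub ((min_le_left _ _).trans_lt hlt)
      rw [lt_div_iff₀ (by linarith)] at h1
      nlinarith
    · have : (m₁ : ℝ) = n - 2 := by exact_mod_cast heq
      rw [this]
      linarith
  have hhc : ContinuousOn h (Ioo 0 t₀) :=
    hC1.continuousOn.mono (Ioo_subset_Ioo_right ht₀.2.le)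
  obtain ⟨A, hA⟩ := exists_height_many_zeros hlam hq1 hN hsub hhc hpos hlim0 hε0 hεt hk
  refine ⟨max A 1, by positivity, fun α hα => ?_⟩
  obtain ⟨hsol, hu0, hv0⟩ := hU α
  exact hA α ((le_max_left _ _).trans hα) _ _ hsol.isRadialSol_s6 hu0 hv0
end

section
/- The map I : ℝ → ℝ² satisfies I(0) = (0,0), I(1) = (1,0), and I(−α) = −I(α) for all α ∈ ℝ; moreover I(α) ≠ (0,0) whenever α ≠ 0, and I is injective. -/
open Set Filter

lemma abs_rpow_mul_self_eq {q : ℝ} (hq : 1 < q) (x : ℝ) :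
    |x| ^ (q - 1) * x = max x 0 ^ q - max (-x) 0 ^ q := by
  have hq0 : q ≠ 0 := by linarith
  have key : ∀ y : ℝ, 0 ≤ y → y ^ (q - 1) * y = y ^ q := fun y hy => by
    have := Real.rpow_add_one' hy (y := q - 1) (by simpa using hq0)
    rw [← this, sub_add_cancel]
  rcases le_total 0 x with hx | hx
  · rw [abs_of_nonneg hx, max_eq_left hx, max_eq_right (by linarith), Real.zero_rpow hq0,
      key x hx, sub_zero]
  · rw [abs_of_nonpos hx, max_eq_right hx, max_eq_left (by linarith), Real.zero_rpow hq0,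
      ← key (-x) (by linarith)]
    ring

lemma abs_rpow_sub_rpow_le {q R x y : ℝ} (hq : 1 < q) (hx : x ∈ Icc 0 R) (hy : y ∈ Icc 0 R) :
    |x ^ q - y ^ q| ≤ q * R ^ (q - 1) * |x - y| := by
  refine Convex.norm_image_sub_le_of_norm_hasDerivWithin_le (f := fun z : ℝ => z ^ q)
    (fun z _ => (Real.hasDerivAt_rpow_const (Or.inr hq.le)).hasDerivWithinAt)
    (fun z hz => ?_) (convex_Icc 0 R) hy hx
  have hz0 := Real.rpow_nonneg hz.1 (q - 1)
  rw [Real.norm_of_nonneg (by positivity)]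
  have := Real.rpow_le_rpow hz.1 hz.2 (by linarith : 0 ≤ q - 1)
  gcongr

lemma abs_abs_rpow_mul_self_sub_le {q R x y : ℝ} (hq : 1 < q) (hx : |x| ≤ R) (hy : |y| ≤ R) :
    |(|x| ^ (q - 1) * x) - |y| ^ (q - 1) * y| ≤ 2 * (q * R ^ (q - 1)) * |x - y| := by
  have hR : 0 ≤ R := (abs_nonneg x).trans hx
  have mem : ∀ z : ℝ, |z| ≤ R → max z 0 ∈ Icc 0 R := fun z hz =>
    ⟨le_max_right _ _, max_le ((le_abs_self z).trans hz) hR⟩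
  have hC : 0 ≤ q * R ^ (q - 1) := mul_nonneg (by linarith) (Real.rpow_nonneg hR _)
  have h₁ := (abs_rpow_sub_rpow_le hq (mem x hx) (mem y hy)).trans
    (mul_le_mul_of_nonneg_left (abs_max_sub_max_le_abs x y 0) hC)
  have h₂ := (abs_rpow_sub_rpow_le hq (mem (-x) (by rwa [abs_neg]))
    (mem (-y) (by rwa [abs_neg]))).trans
    (mul_le_mul_of_nonneg_left (abs_max_sub_max_le_abs (-x) (-y) 0) hC)
  rw [show -x - -y = -(x - y) by ring, abs_neg] at h₂
  rw [abs_rpow_mul_self_eq hq, abs_rpow_mul_self_eq hq]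
  rw [abs_le] at h₁ h₂ ⊢
  constructor <;> linarith [h₁.1, h₁.2, h₂.1, h₂.2]

/-- The vector field of the first-order system associated with the ODE of `SolOn`. -/
noncomputable def phaseField (h : ℝ → ℝ) (lam q t : ℝ) (p : ℝ × ℝ) : ℝ × ℝ :=
  (p.2, -(h t * p.2) - lam * (|p.1| ^ (q - 1) * p.1 - p.1))

lemma lipschitzOnWith_phaseField {h : ℝ → ℝ} {lam q t R H : ℝ} (hlam : 0 < lam) (hq : 1 < q)
    (hR : 0 ≤ R) (hH : |h t| ≤ H) :
    LipschitzOnWith (1 + H + lam * (2 * (q * R ^ (q - 1)) + 1)).toNNReal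
      (phaseField h lam q t) {p | |p.1| ≤ R} := by
  have hC : 0 ≤ q * R ^ (q - 1) := mul_nonneg (by linarith) (Real.rpow_nonneg hR _)
  have hH0 : 0 ≤ H := (abs_nonneg _).trans hH
  refine LipschitzOnWith.of_dist_le_mul fun p hp r hr => ?_
  rw [Real.coe_toNNReal _ (by positivity)]
  set D := dist p r
  have hD : 0 ≤ D := dist_nonneg
  have h1 : |p.1 - r.1| ≤ D := by
    rw [← Real.dist_eq]; exact le_max_left _ _
  have h2 : |p.2 - r.2| ≤ D := by
    rw [← Real.dist_eq]; exact le_max_right _ _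
  have hg := abs_abs_rpow_mul_self_sub_le hq hp hr
  rw [Prod.dist_eq]
  refine max_le ?_ ?_
  · rw [Real.dist_eq]
    refine h2.trans (le_mul_of_one_le_left hD ?_)
    have : 0 ≤ lam * (2 * (q * R ^ (q - 1)) + 1) := by positivity
    linarith
  · rw [Real.dist_eq]
    calc |-(h t * p.2) - lam * (|p.1| ^ (q - 1) * p.1 - p.1)
            - (-(h t * r.2) - lam * (|r.1| ^ (q - 1) * r.1 - r.1))|
        = |-(h t * (p.2 - r.2)) - lam * ((|p.1| ^ (q - 1) * p.1 - |r.1| ^ (q - 1) * r.1)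
            - (p.1 - r.1))| := by congr 1; ring
      _ ≤ |h t| * |p.2 - r.2| + lam * (|(|p.1| ^ (q - 1) * p.1) - |r.1| ^ (q - 1) * r.1|
            + |p.1 - r.1|) := by
          refine (abs_sub _ _).trans ?_
          rw [abs_neg, abs_mul, abs_mul, abs_of_pos hlam]
          gcongr
          exact abs_sub _ _
      _ ≤ H * D + lam * (2 * (q * R ^ (q - 1)) * D + D) := by
          gcongr
          exact hg.trans (by gcongr)
      _ ≤ (1 + H + lam * (2 * (q * R ^ (q - 1)) + 1)) * D := by linarith

namespace SolOn

variable {h u u' u'' v v' v'' : ℝ → ℝ} {lam q : ℝ}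

lemma continuousOn {S Sint : Set ℝ} (hu : SolOn h lam q S Sint u u' u'') : ContinuousOn u S :=
  fun t ht => (hu.1 t ht).continuousWithinAt

lemma neg {S Sint : Set ℝ} (hu : SolOn h lam q S Sint u u' u'') :
    SolOn h lam q S Sint (fun t => -u t) (fun t => -u' t) (fun t => -u'' t) := by
  obtain ⟨h1, h2, h3, h4, h5⟩ := hu
  refine ⟨fun t ht => (h1 t ht).fun_neg, h2.neg, fun t ht => (h3 t ht).fun_neg, h4.neg,
    fun t ht => ?_⟩
  have := h5 t ht
  rw [abs_neg]
  linear_combination -this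

lemma const (S Sint : Set ℝ) {c : ℝ} (hc : |c| ^ (q - 1) * c - c = 0) :
    SolOn h lam q S Sint (fun _ => c) (fun _ => 0) (fun _ => 0) :=
  ⟨fun _ _ => hasDerivWithinAt_const .., continuousOn_const,
    fun _ _ => hasDerivWithinAt_const .., continuousOn_const, fun _ _ => by simp [hc]⟩

lemma hasDerivWithinAt_phase {t₀ t : ℝ} (ht : t ∈ Ioc 0 t₀)
    (hu : SolOn h lam q (Icc 0 t₀) (Ioc 0 t₀) u u' u'') :
    HasDerivWithinAt (fun s => (u s, u' s)) (phaseField h lam q t (u t, u' t)) (Iic t) t := by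
  obtain ⟨h1, h2, h3, h4, h5⟩ := hu
  have hsub : Ioc 0 t ⊆ Ioc 0 t₀ := Ioc_subset_Ioc_right ht.2
  have hmem : Ioc 0 t ∈ nhdsWithin t (Iic t) := Ioc_mem_nhdsLE ht.1
  have hd1 : HasDerivWithinAt u (u' t) (Iic t) t :=
    ((h1 t (Ioc_subset_Icc_self ht)).mono (hsub.trans Ioc_subset_Icc_self)).mono_of_mem_nhdsWithin
      hmem
  have hd2 : HasDerivWithinAt u' (u'' t) (Iic t) t :=
    ((h3 t ht).mono hsub).mono_of_mem_nhdsWithin hmem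
  have heq : u'' t = -(h t * u' t) - lam * (|u t| ^ (q - 1) * u t - u t) := by
    linarith [h5 t ht]
  rw [heq] at hd2
  exact hd1.prodMk hd2

/-- Solutions with the same Cauchy data at the right endpoint agree up to the singular
endpoint `0`. -/
lemma eq_at_zero_of_eq_right {t₀ : ℝ} (hlam : 0 < lam) (hq : 1 < q) (ht₀ : 0 < t₀)
    (hh : ContinuousOn h (Ioc 0 t₀))
    (hu : SolOn h lam q (Icc 0 t₀) (Ioc 0 t₀) u u' u'')
    (hv : SolOn h lam q (Icc 0 t₀) (Ioc 0 t₀) v v' v'')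
    (h0 : u t₀ = v t₀) (h1 : u' t₀ = v' t₀) : u 0 = v 0 := by
  obtain ⟨A, hA⟩ := isCompact_Icc.exists_bound_of_continuousOn hu.continuousOn
  obtain ⟨B, hB⟩ := isCompact_Icc.exists_bound_of_continuousOn hv.continuousOn
  have hR : 0 ≤ max A B := ((norm_nonneg _).trans (hA 0 ⟨le_rfl, ht₀.le⟩)).trans (le_max_left _ _)
  have heq : EqOn u v (Ioc 0 t₀) := by
    intro a ha
    have hsub : Icc a t₀ ⊆ Ioc 0 t₀ := fun s hs => ⟨ha.1.trans_le hs.1, hs.2⟩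
    have hsub' : Icc a t₀ ⊆ Icc 0 t₀ := hsub.trans Ioc_subset_Icc_self
    obtain ⟨H, hH⟩ := isCompact_Icc.exists_bound_of_continuousOn (hh.mono hsub)
    have := ODE_solution_unique_of_mem_Icc_left (a := a) (b := t₀)
      (s := fun _ => {p : ℝ × ℝ | |p.1| ≤ max A B})
      (fun t ht => lipschitzOnWith_phaseField hlam hq hR (hH t (Ioc_subset_Icc_self ht)))
      ((hu.continuousOn.prodMk hu.2.1).mono hsub')
      (fun t ht => hu.hasDerivWithinAt_phase (hsub (Ioc_subset_Icc_self ht)))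
      (fun t ht => (hA t (hsub' (Ioc_subset_Icc_self ht))).trans (le_max_left _ _))
      ((hv.continuousOn.prodMk hv.2.1).mono hsub')
      (fun t ht => hv.hasDerivWithinAt_phase (hsub (Ioc_subset_Icc_self ht)))
      (fun t ht => (hB t (hsub' (Ioc_subset_Icc_self ht))).trans (le_max_right _ _))
      (Prod.ext h0 h1)
    exact congrArg Prod.fst (this ⟨le_rfl, ha.2⟩)
  exact heq.of_subset_closure hu.continuousOn hv.continuousOn Ioc_subset_Icc_self
    (closure_Ioc ht₀.ne).ge ⟨le_rfl, ht₀.le⟩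

end SolOn

theorem stmt_7
    (d lam : ℝ) (hd : 0 < d) (hlam : 0 < lam)
    (n m₁ m₂ : ℤ) (hn : 3 ≤ n)
    (hm₁0 : 0 ≤ m₁) (hm₁n : m₁ ≤ n - 2) (hm₂0 : 0 ≤ m₂) (hm₂n : m₂ ≤ n - 2)
    (h : ℝ → ℝ) (hC1 : ContDiffOn ℝ 1 h (Set.Ioo 0 d))
    (hder : ∀ t ∈ Set.Ioo 0 d, deriv h t < 0)
    (hlim0 : Filter.Tendsto (fun t => t * h t) (nhdsWithin 0 (Set.Ioi 0))
      (nhds ((n : ℝ) - (m₁ : ℝ) - 1)))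
    (hlimd : Filter.Tendsto (fun t => (t - d) * h t) (nhdsWithin d (Set.Iio d))
      (nhds ((n : ℝ) - (m₂ : ℝ) - 1)))
    (q : ℝ) (hq1 : 1 < q)
    (t₀ : ℝ) (ht₀ : t₀ ∈ Set.Ioo 0 d)
    (hpos : ∀ t ∈ Set.Ioo 0 t₀, 0 < h t) (hneg : ∀ t ∈ Set.Ioo t₀ d, h t < 0)
    (U U' U'' : ℝ → ℝ → ℝ)
    (hU : ∀ α : ℝ, SolOn h lam q (Set.Icc 0 t₀) (Set.Ioc 0 t₀) (U α) (U' α) (U'' α) ∧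
      U α 0 = α ∧ U' α 0 = 0)
    (hUuniq : ∀ α : ℝ, ∀ u u' u'' : ℝ → ℝ,
      SolOn h lam q (Set.Icc 0 t₀) (Set.Ioc 0 t₀) u u' u'' → u 0 = α → u' 0 = 0 →
      ∀ t ∈ Set.Icc 0 t₀, u t = U α t ∧ u' t = U' α t)
    :
    (U 0 t₀, U' 0 t₀) = ((0 : ℝ), (0 : ℝ)) ∧
    (U 1 t₀, U' 1 t₀) = ((1 : ℝ), (0 : ℝ)) ∧
    (∀ α : ℝ, U (-α) t₀ = -(U α t₀) ∧ U' (-α) t₀ = -(U' α t₀)) ∧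
    (∀ α : ℝ, α ≠ 0 → (U α t₀, U' α t₀) ≠ ((0 : ℝ), (0 : ℝ))) ∧
    Function.Injective (fun α : ℝ => (U α t₀, U' α t₀)) := by
  have ht₀' : t₀ ∈ Icc 0 t₀ := ⟨ht₀.1.le, le_rfl⟩
  have hh : ContinuousOn h (Ioc 0 t₀) :=
    hC1.continuousOn.mono fun s hs => ⟨hs.1, hs.2.trans_lt ht₀.2⟩
  have hzero : U 0 t₀ = 0 ∧ U' 0 t₀ = 0 := by
    have := hUuniq 0 _ _ _ (SolOn.const _ _ (by simp)) rfl rfl t₀ ht₀'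
    exact ⟨this.1.symm, this.2.symm⟩
  have hone : U 1 t₀ = 1 ∧ U' 1 t₀ = 0 := by
    have := hUuniq 1 _ _ _ (SolOn.const _ _ (by simp)) rfl rfl t₀ ht₀'
    exact ⟨this.1.symm, this.2.symm⟩
  have hinj : Function.Injective (fun α : ℝ => (U α t₀, U' α t₀)) := by
    intro α β hαβ
    obtain ⟨h0, h1⟩ := Prod.mk.inj hαβ
    have := SolOn.eq_at_zero_of_eq_right hlam hq1 ht₀.1 hh (hU α).1 (hU β).1 h0 h1
    rwa [(hU α).2.1, (hU β).2.1] at this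
  refine ⟨Prod.ext hzero.1 hzero.2, Prod.ext hone.1 hone.2, fun α => ?_, fun α hα h0 => ?_, hinj⟩
  · have := hUuniq (-α) _ _ _ (hU α).1.neg (by simp [(hU α).2.1]) (by simp [(hU α).2.2]) t₀ ht₀'
    exact ⟨this.1.symm, this.2.symm⟩
  · exact hα (hinj (h0.trans (Prod.ext hzero.1 hzero.2).symm))
end

section
/- For every α ∈ ℝ there exist δ ∈ (0,A] and a function w ∈ C¹([0,δ]) ∩ C²((0,δ]) with w(0) = α and w'(0) = 0 satisfying the singular ODE on (0,δ]; any two such local solutions agree on the intersection of their domains; and the solution depends continuously on the initial value in the C¹ topology: for every α₀ ∈ ℝ there exists δ > 0 such that the solutions w_α exist on [0,δ] for all α in a neighborhood of α₀, and for every η > 0 there is a neighborhood V of α₀ with sup_{t ∈ [0,δ]} (|w_α(t) − w_{α₀}(t)| + |w_α'(t) − w_{α₀}'(t)|) < η for all α ∈ V. -/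
open Set Filter

/-- The nonlinearity `|u|^{p-1} u` is continuously differentiable for `p > 1`. -/
lemma hasDerivAt_abs_rpow_mul_self {p : ℝ} (hp : 1 < p) (x : ℝ) :
    HasDerivAt (fun u : ℝ => |u| ^ (p - 1) * u) (p * |x| ^ (p - 1)) x := by
  rcases eq_or_ne x 0 with rfl | hx
  · rw [hasDerivAt_iff_tendsto_slope]
    have hc : ContinuousAt (fun u : ℝ => |u| ^ (p - 1)) 0 :=
      continuousAt_id.abs.rpow_const (Or.inr (by linarith))
    have h0 : |(0 : ℝ)| ^ (p - 1) = 0 := by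
      rw [abs_zero, Real.zero_rpow (by linarith)]
    have hc' := hc.tendsto.mono_left (nhdsWithin_le_nhds (s := {0}ᶜ))
    simp only [h0] at hc' ⊢
    rw [mul_zero]
    refine hc'.congr' ?_
    filter_upwards [self_mem_nhdsWithin] with u hu
    have hu : u ≠ 0 := hu
    simp only [slope_def_field, mul_zero, sub_zero]
    field_simp
  · have habs : 0 < |x| := abs_pos.mpr hx
    have h := ((hasDerivAt_abs hx).rpow_const (p := p - 1) (Or.inl habs.ne')).mul (hasDerivAt_id x)
    refine h.congr_deriv ?_
    have hs : (SignType.sign x : ℝ) * x = |x| := sign_mul_self x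
    have hr : |x| ^ (p - 1 - 1) * |x| = |x| ^ (p - 1) := by
      rw [← Real.rpow_add_one habs.ne']; congr 1; ring
    simp only [id, mul_one]
    linear_combination (p - 1) * |x| ^ (p - 1 - 1) * hs + (p - 1) * hr

lemma exists_lipschitz_reaction {p : ℝ} (hp : 1 < p) (lam : ℝ) {M : ℝ} (hM : 0 ≤ M) :
    ∃ L : ℝ, 0 ≤ L ∧ ∀ u v : ℝ, |u| ≤ M → |v| ≤ M →
      |(-lam * (|u| ^ (p - 1) * u - u)) - (-lam * (|v| ^ (p - 1) * v - v))| ≤ L * |u - v| := by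
  refine ⟨|lam| * (p * M ^ (p - 1) + 1), by positivity, fun u v hu hv => ?_⟩
  have key := (convex_Icc (-M) M).norm_image_sub_le_of_norm_hasDerivWithin_le
    (f := fun u : ℝ => |u| ^ (p - 1) * u) (f' := fun x => p * |x| ^ (p - 1))
    (C := p * M ^ (p - 1)) (x := v) (y := u)
    (fun x _ => (hasDerivAt_abs_rpow_mul_self hp x).hasDerivWithinAt)
    (fun x hx => by
      rw [Real.norm_of_nonneg (by positivity)]
      have : |x| ^ (p - 1) ≤ M ^ (p - 1) :=
        Real.rpow_le_rpow (abs_nonneg x) (abs_le.mpr hx) (by linarith)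
      gcongr)
    (abs_le.mp hv) (abs_le.mp hu)
  simp only [Real.norm_eq_abs] at key
  rw [show (-lam * (|u| ^ (p - 1) * u - u)) - (-lam * (|v| ^ (p - 1) * v - v))
      = -lam * ((|u| ^ (p - 1) * u - |v| ^ (p - 1) * v) - (u - v)) by ring,
    abs_mul, abs_neg, mul_assoc]
  refine mul_le_mul_of_nonneg_left ?_ (abs_nonneg _)
  have := abs_sub (|u| ^ (p - 1) * u - |v| ^ (p - 1) * v) (u - v)
  linarith

/-- The truncation of `f` to a bounded, globally Lipschitz function. -/
lemma exists_truncation {f : ℝ → ℝ} {M L : ℝ} (hM : 0 ≤ M) (hL : 0 ≤ L)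
    (hf : ∀ u v : ℝ, |u| ≤ M → |v| ≤ M → |f u - f v| ≤ L * |u - v|) :
    ∃ (F : ℝ → ℝ) (B : ℝ), 0 ≤ B ∧ (∀ u v, |F u - F v| ≤ L * |u - v|) ∧ (∀ u, |F u| ≤ B) ∧
      ∀ u, |u| ≤ M → F u = f u := by
  have hb : ∀ u : ℝ, |max (-M) (min M u)| ≤ M := fun u =>
    abs_le.mpr ⟨le_max_left _ _, max_le (by linarith) (min_le_left _ _)⟩
  refine ⟨fun u => f (max (-M) (min M u)), |f 0| + L * M, by positivity, fun u v => ?_,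
    fun u => ?_, fun u hu => ?_⟩
  · refine (hf _ _ (hb u) (hb v)).trans (mul_le_mul_of_nonneg_left ?_ hL)
    refine (abs_max_sub_max_le_max _ _ _ _).trans ?_
    rw [sub_self, abs_zero]
    refine max_le (abs_nonneg _) ((abs_min_sub_min_le_max _ _ _ _).trans ?_)
    rw [sub_self, abs_zero]
    exact max_le (abs_nonneg _) le_rfl
  · have h1 := hf _ 0 (hb u) (by simpa using hM)
    have h2 := abs_sub_abs_le_abs_sub (f (max (-M) (min M u))) (f 0)
    have h3 := mul_le_mul_of_nonneg_left (hb u) hL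
    rw [sub_zero] at h1
    linarith
  · have := abs_le.mp hu
    simp only [min_eq_right this.2, max_eq_right this.1]

/-- The integrating factor `exp (∫₁ʳ H(s)/s ds)`, extended by zero to `r ≤ 0`. -/
noncomputable def integratingFactor (H : ℝ → ℝ) (r : ℝ) : ℝ :=
  if r ≤ 0 then 0 else Real.exp (∫ s in (1 : ℝ)..r, H s / s)

lemma integratingFactor_pos (H : ℝ → ℝ) {r : ℝ} (hr : 0 < r) : 0 < integratingFactor H r := by
  rw [integratingFactor, if_neg hr.not_ge]
  exact Real.exp_pos _

lemma integratingFactor_nonneg (H : ℝ → ℝ) (r : ℝ) : 0 ≤ integratingFactor H r := by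
  rcases le_or_gt r 0 with hr | hr
  · simp [integratingFactor, hr]
  · exact (integratingFactor_pos H hr).le

lemma hasDerivAt_integratingFactor {H : ℝ → ℝ} (hH : Continuous H) {r : ℝ} (hr : 0 < r) :
    HasDerivAt (integratingFactor H) (H r / r * integratingFactor H r) r := by
  have hcont : ContinuousOn (fun s => H s / s) (Ioi 0) :=
    hH.continuousOn.div continuousOn_id fun s hs => (ne_of_gt hs)
  have hsub : uIcc 1 r ⊆ Ioi 0 := fun s hs => lt_of_lt_of_le (lt_min one_pos hr) hs.1
  have h1 : HasDerivAt (fun u => ∫ s in (1 : ℝ)..u, H s / s) (H r / r) r :=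
    intervalIntegral.integral_hasDerivAt_right (hcont.mono hsub).intervalIntegrable
      (hcont.stronglyMeasurableAtFilter isOpen_Ioi r hr) (hcont.continuousAt (Ioi_mem_nhds hr))
  refine (h1.exp.congr_of_eventuallyEq ?_).congr_deriv ?_
  · filter_upwards [Ioi_mem_nhds hr] with s hs
    rw [integratingFactor, if_neg (not_le.mpr hs)]
  · rw [integratingFactor, if_neg hr.not_ge, mul_comm]

lemma monotone_integratingFactor {H : ℝ → ℝ} (hH : Continuous H)
    (hpos : ∀ r, 0 < H r) : Monotone (integratingFactor H) := by
  have hmono : MonotoneOn (integratingFactor H) (Ioi 0) := by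
    refine monotoneOn_of_deriv_nonneg (convex_Ioi 0)
      (fun r hr => (hasDerivAt_integratingFactor hH hr).continuousAt.continuousWithinAt)
      (fun r hr => ?_) (fun r hr => ?_) <;> rw [interior_Ioi] at hr
    · exact (hasDerivAt_integratingFactor hH hr).differentiableAt.differentiableWithinAt
    · rw [(hasDerivAt_integratingFactor hH hr).deriv]
      have hr : 0 < r := hr
      exact mul_nonneg (div_pos (hpos r) hr).le (integratingFactor_nonneg H r)
  intro a b hab
  rcases le_or_gt a 0 with ha | ha
  · rw [integratingFactor, if_pos ha]
    exact integratingFactor_nonneg H b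
  · exact hmono ha (lt_of_lt_of_le ha hab) hab

/-- The solution `v` of `v' + (H/r) v = φ` vanishing at `0`. -/
noncomputable def linearSolution (H φ : ℝ → ℝ) (r : ℝ) : ℝ :=
  (integratingFactor H r)⁻¹ * ∫ s in (0 : ℝ)..r, integratingFactor H s * φ s

lemma linearSolution_of_nonpos (H φ : ℝ → ℝ) {r : ℝ} (hr : r ≤ 0) : linearSolution H φ r = 0 := by
  simp [linearSolution, integratingFactor, hr]

lemma intervalIntegrable_integratingFactor_mul {H φ : ℝ → ℝ} (hH : Continuous H)
    (hpos : ∀ r, 0 < H r) (hφ : Continuous φ) (a b : ℝ) :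
    IntervalIntegrable (fun s => integratingFactor H s * φ s) MeasureTheory.volume a b :=
  (monotone_integratingFactor hH hpos).intervalIntegrable.mul_continuousOn hφ.continuousOn

lemma abs_linearSolution_sub_le {H φ ψ : ℝ → ℝ} (hH : Continuous H)
    (hpos : ∀ r, 0 < H r) (hφ : Continuous φ) (hψ : Continuous ψ) {C : ℝ} (hC : ∀ s, |φ s - ψ s| ≤ C)
    {r : ℝ} (hr : 0 ≤ r) : |linearSolution H φ r - linearSolution H ψ r| ≤ C * r := by
  rcases hr.eq_or_lt with rfl | hr'
  · simp [linearSolution_of_nonpos]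
  have hm := integratingFactor_pos H hr'
  rw [linearSolution, linearSolution, ← mul_sub, ← intervalIntegral.integral_sub
    (intervalIntegrable_integratingFactor_mul hH hpos hφ 0 r)
    (intervalIntegrable_integratingFactor_mul hH hpos hψ 0 r), abs_mul, abs_inv, abs_of_pos hm,
    inv_mul_le_iff₀ hm]
  have h := intervalIntegral.norm_integral_le_of_norm_le_const (a := 0) (b := r)
    (f := fun s => integratingFactor H s * φ s - integratingFactor H s * ψ s)
    (C := integratingFactor H r * C) (fun s hs => by
      rw [uIoc_of_le hr] at hs
      rw [← mul_sub, norm_mul, Real.norm_of_nonneg (integratingFactor_nonneg H s)]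
      exact mul_le_mul (monotone_integratingFactor hH hpos hs.2) (hC s) (norm_nonneg _) hm.le)
  rwa [sub_zero, abs_of_nonneg hr, mul_assoc] at h

lemma abs_linearSolution_le {H φ : ℝ → ℝ} (hH : Continuous H)
    (hpos : ∀ r, 0 < H r) (hφ : Continuous φ) {C : ℝ} (hC : ∀ s, |φ s| ≤ C) {r : ℝ} (hr : 0 ≤ r) :
    |linearSolution H φ r| ≤ C * r := by
  have h := abs_linearSolution_sub_le hH hpos hφ (continuous_const (y := (0 : ℝ)))
    (by simpa using hC) hr
  simpa [linearSolution] using h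

lemma hasDerivAt_linearSolution {H φ : ℝ → ℝ} (hH : Continuous H)
    (hpos : ∀ r, 0 < H r) (hφ : Continuous φ) {r : ℝ} (hr : 0 < r) :
    HasDerivAt (linearSolution H φ) (φ r - H r / r * linearSolution H φ r) r := by
  have hm := integratingFactor_pos H hr
  have hd := hasDerivAt_integratingFactor hH hr
  have hcont : ContinuousOn (fun s => integratingFactor H s * φ s) (Ioi 0) := fun s hs =>
    ((hasDerivAt_integratingFactor hH hs).continuousAt.mul hφ.continuousAt).continuousWithinAt
  have hI : HasDerivAt (fun u => ∫ s in (0 : ℝ)..u, integratingFactor H s * φ s)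
      (integratingFactor H r * φ r) r :=
    intervalIntegral.integral_hasDerivAt_right
      (intervalIntegrable_integratingFactor_mul hH hpos hφ 0 r)
      (hcont.stronglyMeasurableAtFilter isOpen_Ioi r hr) (hcont.continuousAt (Ioi_mem_nhds hr))
  refine ((hd.inv hm.ne').mul hI).congr_deriv ?_
  rw [linearSolution, Pi.inv_apply]
  field_simp
  ring

lemma continuous_linearSolution {H φ : ℝ → ℝ} (hH : Continuous H)
    (hpos : ∀ r, 0 < H r) (hφ : Continuous φ) {C : ℝ} (hC : ∀ s, |φ s| ≤ C) :
    Continuous (linearSolution H φ) := by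
  rw [continuous_iff_continuousAt]
  intro r
  rcases lt_trichotomy r 0 with hr | rfl | hr
  · refine (continuousAt_const (y := (0 : ℝ))).congr ?_
    filter_upwards [Iio_mem_nhds hr] with s hs
    rw [linearSolution_of_nonpos _ _ (le_of_lt hs)]
  · rw [ContinuousAt, linearSolution_of_nonpos _ _ le_rfl]
    refine squeeze_zero_norm (a := fun s => C * |s|) (fun s => ?_) ?_
    · have hC0 := (abs_nonneg _).trans (hC 0)
      rcases le_total s 0 with hs | hs
      · rw [linearSolution_of_nonpos _ _ hs, norm_zero]
        positivity
      · rw [abs_of_nonneg hs]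
        exact abs_linearSolution_le hH hpos hφ hC hs
    · have : Continuous fun s : ℝ => C * |s| := by fun_prop
      simpa using this.tendsto 0
  · exact (hasDerivAt_linearSolution hH hpos hφ hr).continuousAt

/-- For a bounded, globally Lipschitz right-hand side `F`, the integral equation equivalent to
`w'' + (H/r) w' = F(w)`, `w(0) = α`, `w'(0) = 0` is solvable on a common interval `[0,δ]`, and the
solutions depend on `α` in a Lipschitz way. -/
lemma exists_integral_solutions {H F : ℝ → ℝ} (hH : Continuous H) (hpos : ∀ r, 0 < H r)
    {L B δ : ℝ} (hL : 0 ≤ L) (hδ : 0 ≤ δ) (hLδ : L * δ * δ ≤ 1 / 2)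
    (hF : ∀ u v, |F u - F v| ≤ L * |u - v|) (hB : ∀ u, |F u| ≤ B) :
    ∃ W φ : ℝ → ℝ → ℝ, (∀ α, Continuous (φ α)) ∧ (∀ α s, |φ α s| ≤ B) ∧
      (∀ α, ∀ t ∈ Icc 0 δ, φ α t = F (W α t)) ∧
      (∀ α t, W α t = α + ∫ s in (0 : ℝ)..t, linearSolution H (φ α) s) ∧
      ∀ α β, (∀ t ∈ Icc 0 δ, |W α t - W β t| ≤ 2 * |α - β|) ∧
        ∀ t, |φ α t - φ β t| ≤ 2 * L * |α - β| := by
  have hFc : Continuous F :=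
    (LipschitzWith.of_dist_le_mul (K := ⟨L, hL⟩) fun u v => hF u v).continuous
  let Φ : C(Icc 0 δ, ℝ) → ℝ → ℝ := fun x s => F (IccExtend hδ x s)
  have hΦc : ∀ x, Continuous (Φ x) := fun x => hFc.comp (x.continuous.Icc_extend')
  have hΦB : ∀ x s, |Φ x s| ≤ B := fun x s => hB _
  have hΦL : ∀ x y s, |Φ x s - Φ y s| ≤ L * dist x y := fun x y s =>
    (hF _ _).trans (mul_le_mul_of_nonneg_left
      (ContinuousMap.dist_apply_le_dist (f := x) (g := y) (projIcc 0 δ hδ s)) hL)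
  have hvc : ∀ x, Continuous (linearSolution H (Φ x)) := fun x =>
    continuous_linearSolution hH hpos (hΦc x) (hΦB x)
  have hPc : ∀ x, Continuous fun t => ∫ s in (0 : ℝ)..t, linearSolution H (Φ x) s := fun x =>
    intervalIntegral.continuous_primitive (fun a b => (hvc x).intervalIntegrable a b) 0
  let T : ℝ → C(Icc 0 δ, ℝ) → C(Icc 0 δ, ℝ) := fun α x =>
    ⟨fun t => α + ∫ s in (0 : ℝ)..t, linearSolution H (Φ x) s,
      continuous_const.add ((hPc x).comp continuous_subtype_val)⟩
  have hT : ∀ α β x y, dist (T α x) (T β y) ≤ |α - β| + 1 / 2 * dist x y := by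
    intro α β x y
    rw [ContinuousMap.dist_le (by positivity)]
    rintro ⟨t, ht0, htδ⟩
    have hI := intervalIntegral.norm_integral_le_of_norm_le_const (a := 0) (b := t)
      (f := fun s => linearSolution H (Φ x) s - linearSolution H (Φ y) s)
      (C := L * dist x y * δ) (fun s hs => by
        rw [uIoc_of_le ht0] at hs
        refine (abs_linearSolution_sub_le hH hpos (hΦc x) (hΦc y) (hΦL x y) hs.1.le).trans ?_
        exact mul_le_mul_of_nonneg_left (hs.2.trans htδ) (by positivity))
    rw [intervalIntegral.integral_sub ((hvc x).intervalIntegrable _ _)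
      ((hvc y).intervalIntegrable _ _), Real.norm_eq_abs, sub_zero, abs_of_nonneg ht0] at hI
    have h1 : L * dist x y * δ * t ≤ 1 / 2 * dist x y := by
      calc L * dist x y * δ * t ≤ L * dist x y * δ * δ := by gcongr
        _ = L * δ * δ * dist x y := by ring
        _ ≤ 1 / 2 * dist x y := by gcongr
    rw [Real.dist_eq]
    change |(α + ∫ s in (0 : ℝ)..t, linearSolution H (Φ x) s)
      - (β + ∫ s in (0 : ℝ)..t, linearSolution H (Φ y) s)| ≤ _
    rw [add_sub_add_comm]
    exact (abs_add_le _ _).trans (by linarith)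
  have hcontr : ∀ α, ContractingWith (1 / 2) (T α) := fun α =>
    ⟨by norm_num, LipschitzWith.of_dist_le_mul fun x y => by
      simpa using hT α α x y⟩
  have : Nonempty C(Icc 0 δ, ℝ) := ⟨0⟩
  let X : ℝ → C(Icc 0 δ, ℝ) := fun α => (hcontr α).fixedPoint
  have hX : ∀ α, T α (X α) = X α := fun α => (hcontr α).fixedPoint_isFixedPt
  have hXd : ∀ α β, dist (X α) (X β) ≤ 2 * |α - β| := fun α β => by
    have := hT α β (X α) (X β)
    rw [hX, hX] at this
    linarith
  have hXt : ∀ α t (ht : t ∈ Icc 0 δ),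
      α + ∫ s in (0 : ℝ)..t, linearSolution H (Φ (X α)) s = X α ⟨t, ht⟩ := fun α t ht =>
    congrArg (fun x : C(Icc 0 δ, ℝ) => x ⟨t, ht⟩) (hX α)
  refine ⟨fun α t => α + ∫ s in (0 : ℝ)..t, linearSolution H (Φ (X α)) s, fun α => Φ (X α),
    fun α => hΦc _, fun α => hΦB _, fun α t ht => ?_, fun α t => rfl,
    fun α β => ⟨fun t ht => ?_, fun t => ?_⟩⟩
  · simp only [hXt α t ht, Φ, IccExtend_of_mem _ _ ht]
  · simp only [hXt α t ht, hXt β t ht]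
    exact (ContinuousMap.dist_apply_le_dist _).trans (hXd α β)
  · refine (hΦL _ _ t).trans ?_
    linarith [mul_le_mul_of_nonneg_left (hXd α β) hL]

lemma SolOn.congr {h k : ℝ → ℝ} {lam q : ℝ} {S Sint : Set ℝ} {u u' u'' : ℝ → ℝ}
    (hu : SolOn h lam q S Sint u u' u'') (hhk : EqOn h k Sint) :
    SolOn k lam q S Sint u u' u'' :=
  ⟨hu.1, hu.2.1, hu.2.2.1, hu.2.2.2.1, fun t ht => hhk ht ▸ hu.2.2.2.2 t ht⟩

lemma SolOn.mono {h : ℝ → ℝ} {lam q : ℝ} {S S' T T' : Set ℝ} {u u' u'' : ℝ → ℝ}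
    (hu : SolOn h lam q S T u u' u'') (hS : S' ⊆ S) (hT : T' ⊆ T) :
    SolOn h lam q S' T' u u' u'' :=
  ⟨fun t ht => (hu.1 t (hS ht)).mono hS, hu.2.1.mono hS, fun t ht => (hu.2.2.1 t (hT ht)).mono hT,
    hu.2.2.2.1.mono hT, fun t ht => hu.2.2.2.2 t (hT ht)⟩

/-- Local solvability, with Lipschitz dependence on the initial value in the `C¹` topology. -/
lemma exists_solutions_near {A lam p : ℝ} (hA : 0 < A) (hp : 1 < p) {H : ℝ → ℝ}
    (hH : ContinuousOn H (Icc 0 A)) (hpos : ∀ r ∈ Icc 0 A, 0 < H r) (α₀ : ℝ) :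
    ∃ δ : ℝ, 0 < δ ∧ δ ≤ A ∧ ∃ W W' W'' : ℝ → ℝ → ℝ,
      (∀ α, |α - α₀| < 1 → SolOn (fun r => H r / r) lam p (Icc 0 δ) (Ioc 0 δ)
        (W α) (W' α) (W'' α) ∧ W α 0 = α ∧ W' α 0 = 0) ∧
      ∃ K : ℝ, 0 < K ∧ ∀ α, ∀ t ∈ Icc 0 δ,
        |W α t - W α₀ t| + |W' α t - W' α₀ t| ≤ K * |α - α₀| := by
  obtain ⟨L, hL, hfL⟩ := exists_lipschitz_reaction hp lam (M := |α₀| + 2) (by positivity)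
  obtain ⟨F, B, hB0, hFL, hFB, hFf⟩ :=
    exists_truncation (f := fun u => -lam * (|u| ^ (p - 1) * u - u)) (by positivity) hL hfL
  let G : ℝ → ℝ := IccExtend hA.le ((Icc 0 A).domRestrict H)
  have hG : Continuous G := hH.domRestrict.Icc_extend'
  have hGpos : ∀ r, 0 < G r := fun r => hpos _ (projIcc 0 A hA.le r).2
  have hGH : ∀ r ∈ Icc 0 A, G r = H r := fun r hr => IccExtend_of_mem _ _ hr
  have hD : 0 < 2 * (L + B + 1) := by positivity
  obtain ⟨δ, hδ, hδA, hδD⟩ : ∃ δ : ℝ, 0 < δ ∧ δ ≤ A ∧ δ * (2 * (L + B + 1)) ≤ 1 :=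
    ⟨min A (1 / (2 * (L + B + 1))), by positivity, min_le_left _ _,
      (le_div_iff₀ hD).mp (min_le_right _ _)⟩
  have hδL : 0 ≤ δ * L := by positivity
  have hδB : 0 ≤ δ * B := by positivity
  have hδ1 : δ ≤ 1 := by linarith
  have hLδ : L * δ * δ ≤ 1 / 2 := by
    have := mul_le_of_le_one_right hδL hδ1
    linarith
  have hBδ : B * δ * δ ≤ 1 := by
    have := mul_le_of_le_one_right hδB hδ1
    linarith
  obtain ⟨W, φ, hφc, hφB, hφW, hW, hdep⟩ :=
    exists_integral_solutions hG hGpos hL hδ.le hLδ hFL hFB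
  have hv : ∀ α, Continuous (linearSolution G (φ α)) := fun α =>
    continuous_linearSolution hG hGpos (hφc α) (hφB α)
  have hWd : ∀ α t, HasDerivAt (W α) (linearSolution G (φ α) t) t := fun α t => by
    rw [show W α = fun t => α + ∫ s in (0 : ℝ)..t, linearSolution G (φ α) s from funext (hW α)]
    exact ((hv α).integral_hasStrictDerivAt 0 t).hasDerivAt.const_add α
  have hWbound : ∀ α, |α - α₀| < 1 → ∀ t ∈ Icc 0 δ, |W α t| ≤ |α₀| + 2 := by
    intro α hα t ht
    have hI := intervalIntegral.norm_integral_le_of_norm_le_const (a := 0) (b := t)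
      (f := linearSolution G (φ α)) (C := B * δ) (fun s hs => by
        rw [uIoc_of_le ht.1] at hs
        refine (abs_linearSolution_le hG hGpos (hφc α) (hφB α) hs.1.le).trans ?_
        exact mul_le_mul_of_nonneg_left (hs.2.trans ht.2) hB0)
    rw [Real.norm_eq_abs, sub_zero, abs_of_nonneg ht.1] at hI
    have h1 : B * δ * t ≤ B * δ * δ := mul_le_mul_of_nonneg_left ht.2 (by positivity)
    have h2 := abs_add_le α (∫ s in (0 : ℝ)..t, linearSolution G (φ α) s)
    have h3 := abs_sub_abs_le_abs_sub α α₀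
    rw [hW]
    linarith
  refine ⟨δ, hδ, hδA, W, fun α => linearSolution G (φ α),
    fun α r => φ α r - G r / r * linearSolution G (φ α) r, fun α hα => ⟨?_, ?_, ?_⟩,
    2 + 2 * L * δ, by positivity, fun α t ht => ?_⟩
  · refine SolOn.congr (h := fun r => G r / r) ⟨fun t _ => (hWd α t).hasDerivWithinAt,
      (hv α).continuousOn, fun t ht => (hasDerivAt_linearSolution hG hGpos (hφc α)
        ht.1).hasDerivWithinAt, ?_, fun t ht => ?_⟩ ?_
    · exact (hφc α).continuousOn.sub ((hG.continuousOn.div continuousOn_id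
        fun r hr => hr.1.ne').mul (hv α).continuousOn)
    · have ht' := Ioc_subset_Icc_self ht
      beta_reduce
      rw [hφW α t ht', hFf _ (hWbound α hα t ht')]
      ring
    · intro t ht
      simp only [hGH t ⟨ht.1.le, ht.2.trans hδA⟩]
  · simp [hW]
  · exact linearSolution_of_nonpos _ _ le_rfl
  · have h1 := (hdep α α₀).1 t ht
    have h2 := abs_linearSolution_sub_le hG hGpos (hφc α) (hφc α₀) (hdep α α₀).2 ht.1
    have h3 : 2 * L * |α - α₀| * t ≤ 2 * L * |α - α₀| * δ :=
      mul_le_mul_of_nonneg_left ht.2 (by positivity)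
    linarith

/-- Uniqueness on a common interval, by the differential inequality for
`(w₁ - w₂)² + (w₁' - w₂')²`, in which the singular term has a favourable sign. -/
lemma SolOn.eqOn_of_initial {h : ℝ → ℝ} {lam p δ : ℝ} (hp : 1 < p)
    (hh : ∀ t ∈ Ioc 0 δ, 0 ≤ h t) {w₁ w₁' w₁'' w₂ w₂' w₂'' : ℝ → ℝ}
    (h₁ : SolOn h lam p (Icc 0 δ) (Ioc 0 δ) w₁ w₁' w₁'')
    (h₂ : SolOn h lam p (Icc 0 δ) (Ioc 0 δ) w₂ w₂' w₂'')
    (h0 : w₁ 0 = w₂ 0) (h0' : w₁' 0 = w₂' 0) : EqOn w₁ w₂ (Icc 0 δ) := by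
  have hc₁ : ContinuousOn w₁ (Icc 0 δ) := fun t ht => (h₁.1 t ht).continuousWithinAt
  have hc₂ : ContinuousOn w₂ (Icc 0 δ) := fun t ht => (h₂.1 t ht).continuousWithinAt
  obtain ⟨M₁, hM₁⟩ := isCompact_Icc.exists_bound_of_continuousOn hc₁
  obtain ⟨M₂, hM₂⟩ := isCompact_Icc.exists_bound_of_continuousOn hc₂
  obtain ⟨L, hL, hfL⟩ := exists_lipschitz_reaction hp lam (M := max 0 (max M₁ M₂))
    (le_max_left _ _)
  let E : ℝ → ℝ := fun t =>
    ((w₁ t - w₂ t) ^ 2 + (w₁' t - w₂' t) ^ 2) * Real.exp (-(1 + L) * t)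
  have hEd : ∀ t ∈ Ioo 0 δ, HasDerivAt E
      ((2 * (w₁ t - w₂ t) * (w₁' t - w₂' t) + 2 * (w₁' t - w₂' t) * (w₁'' t - w₂'' t)
        - (1 + L) * ((w₁ t - w₂ t) ^ 2 + (w₁' t - w₂' t) ^ 2)) * Real.exp (-(1 + L) * t)) t := by
    intro t ht
    have hIcc : Icc 0 δ ∈ nhds t := Icc_mem_nhds ht.1 ht.2
    have hIoc : Ioc 0 δ ∈ nhds t := Ioc_mem_nhds ht.1 ht.2
    have hd := ((h₁.1 t (Ioo_subset_Icc_self ht)).hasDerivAt hIcc).sub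
      ((h₂.1 t (Ioo_subset_Icc_self ht)).hasDerivAt hIcc)
    have hd' := ((h₁.2.2.1 t (Ioo_subset_Ioc_self ht)).hasDerivAt hIoc).sub
      ((h₂.2.2.1 t (Ioo_subset_Ioc_self ht)).hasDerivAt hIoc)
    have he := ((hasDerivAt_id t).const_mul (-(1 + L))).exp
    refine (((hd.pow 2).add (hd'.pow 2)).mul he).congr_deriv ?_
    simp only [Pi.sub_apply, Pi.add_apply, Pi.pow_apply, id]
    push_cast
    ring
  have hanti : AntitoneOn E (Icc 0 δ) := by
    refine antitoneOn_of_deriv_nonpos (convex_Icc 0 δ) ?_ (fun t ht => ?_) (fun t ht => ?_)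
    · exact (((hc₁.sub hc₂).pow 2).add ((h₁.2.1.sub h₂.2.1).pow 2)).mul (by fun_prop)
    · rw [interior_Icc] at ht
      exact (hEd t ht).differentiableAt.differentiableWithinAt
    · rw [interior_Icc] at ht
      rw [(hEd t ht).deriv]
      refine mul_nonpos_of_nonpos_of_nonneg ?_ (Real.exp_pos _).le
      have hIcc := Ioo_subset_Icc_self ht
      have hIoc := Ioo_subset_Ioc_self ht
      have hlip := hfL (w₁ t) (w₂ t)
        ((hM₁ t hIcc).trans ((le_max_left _ _).trans (le_max_right _ _)))
        ((hM₂ t hIcc).trans ((le_max_right _ _).trans (le_max_right _ _)))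
      have e₁ := h₁.2.2.2.2 t hIoc
      have e₂ := h₂.2.2.2.2 t hIoc
      set d := w₁ t - w₂ t
      set v := w₁' t - w₂' t
      set g := (-lam * (|w₁ t| ^ (p - 1) * w₁ t - w₁ t)) -
        (-lam * (|w₂ t| ^ (p - 1) * w₂ t - w₂ t)) with hg
      have hdiff : w₁'' t - w₂'' t = g - h t * v := by
        simp only [hg, v]
        linear_combination e₁ - e₂
      have hvg : v * g ≤ |v| * (L * |d|) :=
        (le_abs_self _).trans ((abs_mul v g).le.trans
          (mul_le_mul_of_nonneg_left hlip (abs_nonneg v)))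
      have hvd : 2 * (|v| * |d|) ≤ v ^ 2 + d ^ 2 := by
        have := two_mul_le_add_sq |v| |d|
        rw [sq_abs, sq_abs] at this
        linarith
      have hdv : 2 * d * v ≤ d ^ 2 + v ^ 2 := two_mul_le_add_sq d v
      have hsing : 0 ≤ h t * v ^ 2 := mul_nonneg (hh t hIoc) (sq_nonneg v)
      have hLvd := mul_le_mul_of_nonneg_left hvd hL
      rw [hdiff]
      linarith
  intro t ht
  have hE : E t ≤ E 0 := hanti ⟨le_rfl, ht.1.trans ht.2⟩ ht ht.1
  have hE0 : E 0 = 0 := by simp [E, h0, h0']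
  rw [hE0] at hE
  have hsum := nonpos_of_mul_nonpos_left hE (Real.exp_pos _)
  have hsq : (w₁ t - w₂ t) ^ 2 = 0 :=
    le_antisymm (by linarith [sq_nonneg (w₁' t - w₂' t)]) (sq_nonneg _)
  exact sub_eq_zero.mp (pow_eq_zero_iff two_ne_zero |>.mp hsq)

theorem stmt_8
    (A lam p : ℝ) (hA : 0 < A) (hlam : 0 < lam) (hp : 1 < p)
    (H : ℝ → ℝ) (hHC1 : ContDiffOn ℝ 1 H (Set.Icc 0 A))
    (hHpos : ∀ r ∈ Set.Icc 0 A, 0 < H r) :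
    (∀ α : ℝ, ∃ δ : ℝ, 0 < δ ∧ δ ≤ A ∧
      ∃ w w' w'' : ℝ → ℝ,
        SolOn (fun r => H r / r) lam p (Set.Icc 0 δ) (Set.Ioc 0 δ) w w' w'' ∧
        w 0 = α ∧ w' 0 = 0) ∧
    (∀ α : ℝ, ∀ δ₁ δ₂ : ℝ, 0 < δ₁ → δ₁ ≤ A → 0 < δ₂ → δ₂ ≤ A →
      ∀ w₁ w₁' w₁'' w₂ w₂' w₂'' : ℝ → ℝ,
        SolOn (fun r => H r / r) lam p (Set.Icc 0 δ₁) (Set.Ioc 0 δ₁) w₁ w₁' w₁'' →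
        w₁ 0 = α → w₁' 0 = 0 →
        SolOn (fun r => H r / r) lam p (Set.Icc 0 δ₂) (Set.Ioc 0 δ₂) w₂ w₂' w₂'' →
        w₂ 0 = α → w₂' 0 = 0 →
        ∀ t ∈ Set.Icc 0 (min δ₁ δ₂), w₁ t = w₂ t) ∧
    (∀ α₀ : ℝ, ∃ δ : ℝ, 0 < δ ∧ δ ≤ A ∧ ∃ ρ : ℝ, 0 < ρ ∧
      ∃ W W' W'' : ℝ → ℝ → ℝ,
        (∀ α : ℝ, |α - α₀| < ρ →
          SolOn (fun r => H r / r) lam p (Set.Icc 0 δ) (Set.Ioc 0 δ)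
            (W α) (W' α) (W'' α) ∧ W α 0 = α ∧ W' α 0 = 0) ∧
        (∀ η : ℝ, 0 < η → ∃ ρ' : ℝ, 0 < ρ' ∧ ρ' ≤ ρ ∧
          ∀ α : ℝ, |α - α₀| < ρ' →
            ∀ t ∈ Set.Icc 0 δ, |W α t - W α₀ t| + |W' α t - W' α₀ t| < η)) := by
  refine ⟨fun α => ?_, ?_, fun α₀ => ?_⟩
  · obtain ⟨δ, hδ, hδA, W, W', W'', hsol, -⟩ :=
      exists_solutions_near (lam := lam) hA hp hHC1.continuousOn hHpos α
    exact ⟨δ, hδ, hδA, W α, W' α, W'' α, hsol α (by simp)⟩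
  · intro α δ₁ δ₂ _ hδ₁ _ _ w₁ w₁' w₁'' w₂ w₂' w₂'' h₁ h₁0 h₁0' h₂ h₂0 h₂0'
    exact SolOn.eqOn_of_initial hp
      (fun t ht => (div_pos (hHpos t ⟨ht.1.le, ht.2.trans ((min_le_left _ _).trans hδ₁)⟩) ht.1).le)
      (h₁.mono (Icc_subset_Icc_right (min_le_left _ _)) (Ioc_subset_Ioc_right (min_le_left _ _)))
      (h₂.mono (Icc_subset_Icc_right (min_le_right _ _)) (Ioc_subset_Ioc_right (min_le_right _ _)))
      (h₁0.trans h₂0.symm) (h₁0'.trans h₂0'.symm)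
  · obtain ⟨δ, hδ, hδA, W, W', W'', hsol, K, hK, hdep⟩ :=
      exists_solutions_near (lam := lam) hA hp hHC1.continuousOn hHpos α₀
    refine ⟨δ, hδ, hδA, 1, one_pos, W, W', W'', hsol, fun η hη =>
      ⟨min 1 (η / K), by positivity, min_le_left _ _, fun α hα t ht => ?_⟩⟩
    have hlt : |α - α₀| * K < η := (lt_div_iff₀ hK).mp (hα.trans_le (min_le_right _ _))
    linarith [hdep α t ht]
end
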